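/- arXiv:2202.08800 — 2 statements merged into one kernel-verified Lean document; each statement's English description precedes it below -/
import Mathlib

section
/- The distance Laplacian spectrum of SK_{n,4} + e (the complete split graph with independent set of size 4 plus an edge inside that set) is: n + 4 with multiplicity 2, n + 2 with multiplicity 1, n with multiplicity n - 4, and 0 with multiplicity 1. -/
open Matrix

/-- The transmission of a vertex: sum of distances to all other vertices. -/
noncomputable def transmission {V : Type*} [Fintype V] (G : SimpleGraph V) (v : V) : ℕ :=
  ∑ u, G.dist v u

/-- The distance Laplacian matrix `D^L(G) = Diag(Tr) - D(G)`. -/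
noncomputable def distLapMatrix {V : Type*} [Fintype V] [DecidableEq V]
    (G : SimpleGraph V) : Matrix V V ℝ :=
  fun u v => if u = v then (transmission G u : ℝ) else -(G.dist u v : ℝ)

/-- `μ` is an eigenvalue of the real matrix `M`. -/
def IsEigenvalue {V : Type*} [Fintype V] [DecidableEq V] (M : Matrix V V ℝ) (μ : ℝ) : Prop :=
  Module.End.HasEigenvalue (Matrix.toLin' M) μ

/-- The multiplicity of `μ` as an eigenvalue of `M` (dimension of the eigenspace). -/
noncomputable def eigMult {V : Type*} [Fintype V] [DecidableEq V]
    (M : Matrix V V ℝ) (μ : ℝ) : ℕ :=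
  Module.finrank ℝ (Module.End.eigenspace (Matrix.toLin' M) μ)

/-- Complete multipartite graph on `Fin n` plus one extra edge `xy` (inside a block). -/
def multipartitePlusE (n : ℕ) (blk : Fin n → ℕ) (x y : Fin n) : SimpleGraph (Fin n) :=
  SimpleGraph.fromRel (fun u v => blk u ≠ blk v ∨ (u = x ∧ v = y))

lemma distLapMatrix_mulVec {V : Type*} [Fintype V] [DecidableEq V] (G : SimpleGraph V)
    (f : V → ℝ) (u : V) :
    (distLapMatrix G *ᵥ f) u = ∑ v, (G.dist u v : ℝ) * (f u - f v) := by
  have h : ∀ v, distLapMatrix G u v * f v =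
      (if u = v then (transmission G u : ℝ) * f u else 0) - (G.dist u v : ℝ) * f v := by
    intro v
    by_cases huv : u = v
    · subst huv
      simp [distLapMatrix]
    · simp [distLapMatrix, huv]
  simp only [mulVec, dotProduct, h, Finset.sum_sub_distrib, mul_sub, Finset.sum_ite_eq,
    Finset.mem_univ, if_true, ← Finset.sum_mul, transmission, Nat.cast_sum]

lemma sum_distLapMatrix_mulVec {V : Type*} [Fintype V] [DecidableEq V] (G : SimpleGraph V)
    (f : V → ℝ) : ∑ u, (distLapMatrix G *ᵥ f) u = 0 := by
  simp only [distLapMatrix_mulVec, mul_sub, Finset.sum_sub_distrib]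
  rw [sub_eq_zero, Finset.sum_comm]
  simp only [G.dist_comm]

/-- The complete split graph with independent set `{0, 1, 2, 3}`, plus the edge `01`. -/
abbrev splitPlusEdge (n : ℕ) (hn : 4 < n) : SimpleGraph (Fin n) :=
  multipartitePlusE n (fun v => if v.val < 4 then 0 else v.val) ⟨0, by omega⟩ ⟨1, by omega⟩

lemma splitPlusEdge_adj {n : ℕ} (hn : 4 < n) (u v : Fin n) :
    (splitPlusEdge n hn).Adj u v ↔ u.val ≠ v.val ∧
      (4 ≤ u.val ∨ 4 ≤ v.val ∨ (u.val = 0 ∧ v.val = 1) ∨ (u.val = 1 ∧ v.val = 0)) := by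
  simp only [multipartitePlusE, SimpleGraph.fromRel_adj, Fin.ext_iff, ne_eq]
  split_ifs <;> omega

lemma splitPlusEdge_dist {n : ℕ} (hn : 4 < n) (u v : Fin n) :
    (splitPlusEdge n hn).dist u v = if u.val = v.val then 0 else
      if 4 ≤ u.val ∨ 4 ≤ v.val ∨ (u.val = 0 ∧ v.val = 1) ∨ (u.val = 1 ∧ v.val = 0)
      then 1 else 2 := by
  split_ifs with h h'
  · rw [Fin.ext h, SimpleGraph.dist_self]
  · exact SimpleGraph.dist_eq_one_iff_adj.2 ((splitPlusEdge_adj hn u v).2 ⟨h, h'⟩)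
  · have hu : (splitPlusEdge n hn).Adj u ⟨4, by omega⟩ :=
      (splitPlusEdge_adj hn _ _).2 ⟨by simp only; omega, by simp⟩
    have hv : (splitPlusEdge n hn).Adj ⟨4, by omega⟩ v :=
      (splitPlusEdge_adj hn _ _).2 ⟨by simp only; omega, by simp⟩
    have hle := SimpleGraph.dist_le (hu.toWalk.append hv.toWalk)
    have hne : (splitPlusEdge n hn).dist u v ≠ 1 := fun h1 =>
      h' ((splitPlusEdge_adj hn u v).1 (SimpleGraph.dist_eq_one_iff_adj.1 h1)).2
    have hpos := (hu.reachable.trans hv.reachable).pos_dist_of_ne (fun e => h (congrArg _ e))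
    simp only [SimpleGraph.Walk.length_append, SimpleGraph.Walk.length_cons,
      SimpleGraph.Walk.length_nil] at hle
    omega

section Spectrum

variable {n : ℕ} (hn : 4 < n)

/-- The Laplacian of the complement of `splitPlusEdge n hn`, applied to `f`. -/
def complLap (f : Fin n → ℝ) (u : Fin n) : ℝ :=
  let a := f ⟨0, by omega⟩
  let b := f ⟨1, by omega⟩
  let c := f ⟨2, by omega⟩
  let d := f ⟨3, by omega⟩
  if u.val = 0 then 2 * a - c - d else if u.val = 1 then 2 * b - c - d else
  if u.val = 2 then 3 * c - a - b - d else if u.val = 3 then 3 * d - a - b - c else 0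

lemma distLapMatrix_splitPlusEdge_mulVec (f : Fin n → ℝ) (u : Fin n) :
    (distLapMatrix (splitPlusEdge n hn) *ᵥ f) u = n * f u - ∑ v, f v + complLap hn f u := by
  have key : ∀ v, ((splitPlusEdge n hn).dist u v : ℝ) * (f u - f v) = (f u - f v) +
      ((if v = ⟨0, by omega⟩ then if u.val = 2 ∨ u.val = 3 then f u - f v else 0 else 0) +
      (if v = ⟨1, by omega⟩ then if u.val = 2 ∨ u.val = 3 then f u - f v else 0 else 0) +
      (if v = ⟨2, by omega⟩ then if u.val < 4 then f u - f v else 0 else 0) +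
      (if v = ⟨3, by omega⟩ then if u.val < 4 then f u - f v else 0 else 0)) := by
    intro v
    by_cases huv : u = v
    · simp [huv]
    rw [splitPlusEdge_dist]
    have huv' : u.val ≠ v.val := fun e => huv (Fin.ext e)
    simp only [Fin.ext_iff]
    split_ifs <;> first | omega | (push_cast; ring)
  rw [distLapMatrix_mulVec, Finset.sum_congr rfl fun v _ => key v]
  simp only [Finset.sum_add_distrib, Finset.sum_sub_distrib, Finset.sum_ite_eq', Finset.mem_univ,
    if_true, Finset.sum_const, Finset.card_univ, Fintype.card_fin, nsmul_eq_mul, complLap]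
  congr 1
  obtain ⟨k, hk⟩ := u
  obtain rfl | rfl | rfl | rfl | h : k = 0 ∨ k = 1 ∨ k = 2 ∨ k = 3 ∨ 4 ≤ k := by omega
  · norm_num; ring
  · norm_num; ring
  · norm_num; ring
  · norm_num; ring
  · have h0 : k ≠ 0 := by omega
    have h1 : k ≠ 1 := by omega
    have h2 : k ≠ 2 := by omega
    have h3 : k ≠ 3 := by omega
    simp [h0, h1, h2, h3, h.not_gt]

lemma mem_eigenspace_splitPlusEdge {μ : ℝ} {f : Fin n → ℝ} :
    f ∈ Module.End.eigenspace (toLin' (distLapMatrix (splitPlusEdge n hn))) μ ↔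
      ∀ u, n * f u - ∑ v, f v + complLap hn f u = μ * f u := by
  simp only [Module.End.mem_eigenspace_iff, toLin'_apply, funext_iff,
    distLapMatrix_splitPlusEdge_mulVec, Pi.smul_apply, smul_eq_mul]

lemma complLap_eq (f : Fin n → ℝ) :
    complLap hn f ⟨0, by omega⟩ =
      2 * f ⟨0, by omega⟩ - f ⟨2, by omega⟩ - f ⟨3, by omega⟩ ∧
    complLap hn f ⟨1, by omega⟩ =
      2 * f ⟨1, by omega⟩ - f ⟨2, by omega⟩ - f ⟨3, by omega⟩ ∧
    complLap hn f ⟨2, by omega⟩ =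
      3 * f ⟨2, by omega⟩ - f ⟨0, by omega⟩ - f ⟨1, by omega⟩ - f ⟨3, by omega⟩ ∧
    complLap hn f ⟨3, by omega⟩ =
      3 * f ⟨3, by omega⟩ - f ⟨0, by omega⟩ - f ⟨1, by omega⟩ - f ⟨2, by omega⟩ ∧
    ∀ u : Fin n, 4 ≤ u.val → complLap hn f u = 0 := by
  refine ⟨by simp [complLap], by simp [complLap], by simp [complLap], by simp [complLap],
    fun u hu => ?_⟩
  simp only [complLap]
  split_ifs <;> first | omega | rfl

lemma forall_fin_iff {P : Fin n → Prop} :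
    (∀ u, P u) ↔ P ⟨0, by omega⟩ ∧ P ⟨1, by omega⟩ ∧ P ⟨2, by omega⟩ ∧ P ⟨3, by omega⟩ ∧
      ∀ u : Fin n, 4 ≤ u.val → P u := by
  refine ⟨fun h => ⟨h _, h _, h _, h _, fun u _ => h u⟩, ?_⟩
  rintro ⟨h0, h1, h2, h3, h4⟩ ⟨k, hk⟩
  obtain rfl | rfl | rfl | rfl | h : k = 0 ∨ k = 1 ∨ k = 2 ∨ k = 3 ∨ 4 ≤ k := by omega
  exacts [h0, h1, h2, h3, h4 _ h]

/-- In the coordinates `∑ f`, `f 0 - f 1`, `f 2 - f 3`, ... the eigenvalue equation is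
triangular. -/
lemma eigenspace_splitPlusEdge_equations {μ : ℝ} {f : Fin n → ℝ}
    (hf : f ∈ Module.End.eigenspace (toLin' (distLapMatrix (splitPlusEdge n hn))) μ) :
    μ * ∑ v, f v = 0 ∧
    (n + 2 - μ) * (f ⟨0, by omega⟩ - f ⟨1, by omega⟩) = 0 ∧
    (n + 4 - μ) * (f ⟨2, by omega⟩ - f ⟨3, by omega⟩) = 0 ∧
    (n + 4 - μ) * (f ⟨0, by omega⟩ - f ⟨2, by omega⟩) = f ⟨0, by omega⟩ - f ⟨1, by omega⟩ ∧
    (n - μ) * (f ⟨0, by omega⟩ + f ⟨1, by omega⟩ + f ⟨2, by omega⟩ + f ⟨3, by omega⟩) =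
      4 * ∑ v, f v ∧
    ∀ u : Fin n, 4 ≤ u.val → (n - μ) * f u = ∑ v, f v := by
  have hsum : μ * ∑ v, f v = 0 := by
    rw [Module.End.mem_eigenspace_iff, toLin'_apply] at hf
    have h := sum_distLapMatrix_mulVec (splitPlusEdge n hn) f
    rwa [hf, Finset.sum_congr rfl fun v _ => Pi.smul_apply μ f v, ← Finset.smul_sum,
      smul_eq_mul] at h
  obtain ⟨l0, l1, l2, l3, l4⟩ := complLap_eq hn f
  obtain ⟨h0, h1, h2, h3, h4⟩ :=
    (forall_fin_iff hn).1 ((mem_eigenspace_splitPlusEdge hn).1 hf)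
  rw [l0] at h0
  rw [l1] at h1
  rw [l2] at h2
  rw [l3] at h3
  refine ⟨hsum, by linarith, by linarith, by linarith, by linarith, fun u hu => ?_⟩
  have := h4 u hu
  rw [l4 u hu] at this
  linarith

/-- The vector on `Fin n` with first entries `a, b, c, d` and all others zero. -/
def quadVec (n : ℕ) (a b c d : ℝ) (u : Fin n) : ℝ :=
  if u.val = 0 then a else if u.val = 1 then b else if u.val = 2 then c else
  if u.val = 3 then d else 0

lemma sum_quadVec {n : ℕ} (hn : 4 < n) (a b c d : ℝ) : ∑ u, quadVec n a b c d u = a + b + c + d := by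
  have h : ∀ u : Fin n, quadVec n a b c d u =
      (if u = ⟨0, by omega⟩ then a else 0) + (if u = ⟨1, by omega⟩ then b else 0) +
      (if u = ⟨2, by omega⟩ then c else 0) + (if u = ⟨3, by omega⟩ then d else 0) := by
    intro u
    simp only [quadVec, Fin.ext_iff]
    split_ifs <;> first | omega | simp
  simp [h, Finset.sum_add_distrib]

lemma quadVec_of_le {a b c d : ℝ} {u : Fin n} (hu : 4 ≤ u.val) :
    quadVec n a b c d u = 0 := by
  simp only [quadVec]
  split_ifs <;> first | omega | rfl

lemma quadVec_mem_eigenspace {μ a b c d : ℝ} (hs : a + b + c + d = 0)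
    (ha : n * a + (2 * a - c - d) = μ * a) (hb : n * b + (2 * b - c - d) = μ * b)
    (hc : n * c + (3 * c - a - b - d) = μ * c) (hd : n * d + (3 * d - a - b - c) = μ * d) :
    quadVec n a b c d ∈
      Module.End.eigenspace (toLin' (distLapMatrix (splitPlusEdge n hn))) μ := by
  obtain ⟨l0, l1, l2, l3, l4⟩ := complLap_eq hn (quadVec n a b c d)
  rw [mem_eigenspace_splitPlusEdge hn, forall_fin_iff hn, sum_quadVec hn, l0, l1, l2, l3, hs]
  refine ⟨by simpa [quadVec] using ha, by simpa [quadVec] using hb, by simpa [quadVec] using hc,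
    by simpa [quadVec] using hd, fun u hu => ?_⟩
  rw [l4 u hu, quadVec_of_le hu]
  simp

lemma eigenspace_splitPlusEdge_add_four :
    Module.End.eigenspace (toLin' (distLapMatrix (splitPlusEdge n hn))) ((n : ℝ) + 4) =
      Submodule.span ℝ {quadVec n 1 1 0 (-2), quadVec n 0 0 1 (-1)} := by
  apply le_antisymm
  · intro f hf
    obtain ⟨hS, h1, -, h3, h4, h5⟩ := eigenspace_splitPlusEdge_equations hn hf
    have hS : ∑ v, f v = 0 := (mul_eq_zero.1 hS).resolve_left (by positivity)
    rw [hS] at h4 h5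
    rw [Submodule.mem_span_pair]
    refine ⟨f ⟨0, by omega⟩, f ⟨2, by omega⟩, ?_⟩
    rw [funext_iff, forall_fin_iff hn]
    refine ⟨by simp [quadVec], by simp [quadVec]; linarith, by simp [quadVec],
      by simp [quadVec]; linarith, fun u hu => ?_⟩
    simp only [Pi.add_apply, Pi.smul_apply, quadVec_of_le hu, smul_zero, add_zero]
    linarith [h5 u hu]
  · rw [Submodule.span_le, Set.pair_subset_iff]
    constructor <;> apply quadVec_mem_eigenspace <;> ring

lemma eigenspace_splitPlusEdge_add_two :
    Module.End.eigenspace (toLin' (distLapMatrix (splitPlusEdge n hn))) ((n : ℝ) + 2) =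
      Submodule.span ℝ {quadVec n 1 (-1) 0 0} := by
  apply le_antisymm
  · intro f hf
    obtain ⟨hS, -, h2, h3, h4, h5⟩ := eigenspace_splitPlusEdge_equations hn hf
    have hS : ∑ v, f v = 0 := (mul_eq_zero.1 hS).resolve_left (by positivity)
    rw [hS] at h4 h5
    rw [Submodule.mem_span_singleton]
    refine ⟨f ⟨0, by omega⟩, ?_⟩
    rw [funext_iff, forall_fin_iff hn]
    refine ⟨by simp [quadVec], by simp [quadVec]; linarith, by simp [quadVec]; linarith,
      by simp [quadVec]; linarith, fun u hu => ?_⟩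
    simp only [Pi.smul_apply, quadVec_of_le hu, smul_zero]
    linarith [h5 u hu]
  · rw [Submodule.span_le, Set.singleton_subset_iff]
    apply quadVec_mem_eigenspace <;> ring

lemma eq_of_mem_eigenspace {μ : ℝ} {f : Fin n → ℝ} (h2 : μ ≠ n + 2) (h4 : μ ≠ n + 4)
    (hf : f ∈ Module.End.eigenspace (toLin' (distLapMatrix (splitPlusEdge n hn))) μ) :
    f ⟨0, by omega⟩ = f ⟨1, by omega⟩ ∧ f ⟨1, by omega⟩ = f ⟨2, by omega⟩ ∧
      f ⟨2, by omega⟩ = f ⟨3, by omega⟩ := by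
  obtain ⟨-, e1, e2, e3, -⟩ := eigenspace_splitPlusEdge_equations hn hf
  have e1 := (mul_eq_zero.1 e1).resolve_left (sub_ne_zero.2 h2.symm)
  have e2 := (mul_eq_zero.1 e2).resolve_left (sub_ne_zero.2 h4.symm)
  rw [e1] at e3
  have e3 := (mul_eq_zero.1 e3).resolve_left (sub_ne_zero.2 h4.symm)
  exact ⟨by linarith, by linarith, by linarith⟩

lemma eigenspace_splitPlusEdge_zero :
    Module.End.eigenspace (toLin' (distLapMatrix (splitPlusEdge n hn))) (0 : ℝ) =
      Submodule.span ℝ {fun _ => 1} := by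
  have hn0 : (n : ℝ) ≠ 0 := by
    have : n ≠ 0 := by omega
    exact_mod_cast this
  apply le_antisymm
  · intro f hf
    obtain ⟨-, -, -, -, h4, h5⟩ := eigenspace_splitPlusEdge_equations hn hf
    obtain ⟨e1, e2, e3⟩ := eq_of_mem_eigenspace hn (by positivity) (by positivity) hf
    rw [Submodule.mem_span_singleton]
    refine ⟨f ⟨0, by omega⟩, ?_⟩
    rw [funext_iff, forall_fin_iff hn]
    refine ⟨by simp, by simp; linarith, by simp; linarith, by simp; linarith, fun u hu => ?_⟩
    have h := h5 u hu
    rw [← e3, ← e2, ← e1] at h4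
    simp only [Pi.smul_apply, smul_eq_mul, mul_one]
    exact mul_left_cancel₀ hn0 (by linarith)
  · rw [Submodule.span_le, Set.singleton_subset_iff, SetLike.mem_coe,
      mem_eigenspace_splitPlusEdge hn]
    intro u
    simp only [complLap, Finset.sum_const, Finset.card_univ, Fintype.card_fin, nsmul_eq_mul]
    split_ifs <;> ring

/-- The linear map whose kernel is the eigenspace of `n`. -/
def sumDiffMap : (Fin n → ℝ) →ₗ[ℝ] (Fin 4 → ℝ) where
  toFun f := ![∑ v, f v, f ⟨0, by omega⟩ - f ⟨1, by omega⟩, f ⟨1, by omega⟩ - f ⟨2, by omega⟩,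
    f ⟨2, by omega⟩ - f ⟨3, by omega⟩]
  map_add' f g := by
    ext i
    fin_cases i <;> simp [Finset.sum_add_distrib] <;> ring
  map_smul' r f := by
    ext i
    fin_cases i <;> simp [Finset.mul_sum] <;> ring

lemma eigenspace_splitPlusEdge_self :
    Module.End.eigenspace (toLin' (distLapMatrix (splitPlusEdge n hn))) (n : ℝ) =
      LinearMap.ker (sumDiffMap hn) := by
  have hn0 : (n : ℝ) ≠ 0 := by
    have : n ≠ 0 := by omega
    exact_mod_cast this
  ext f
  have hker : f ∈ LinearMap.ker (sumDiffMap hn) ↔ ∑ v, f v = 0 ∧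
      f ⟨0, by omega⟩ - f ⟨1, by omega⟩ = 0 ∧ f ⟨1, by omega⟩ - f ⟨2, by omega⟩ = 0 ∧
      f ⟨2, by omega⟩ - f ⟨3, by omega⟩ = 0 := by
    simp [sumDiffMap]
  simp only [hker, sub_eq_zero]
  constructor
  · intro hf
    exact ⟨(mul_eq_zero.1 (eigenspace_splitPlusEdge_equations hn hf).1).resolve_left hn0,
      eq_of_mem_eigenspace hn (by simp) (by simp) hf⟩
  · rintro ⟨hS, e1, e2, e3⟩
    rw [mem_eigenspace_splitPlusEdge hn, hS]
    intro u
    simp only [complLap, e1, e2, e3]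
    split_ifs <;> ring

lemma sumDiffMap_surjective : Function.Surjective (sumDiffMap hn) := by
  intro y
  refine ⟨quadVec n (y 1 + y 2 + y 3) (y 2 + y 3) (y 3) 0 +
    Pi.single ⟨4, by omega⟩ (y 0 - (y 1 + 2 * y 2 + 3 * y 3)), ?_⟩
  have hs := sum_quadVec hn (y 1 + y 2 + y 3) (y 2 + y 3) (y 3) 0
  ext i
  fin_cases i
  · simp [sumDiffMap, Finset.sum_add_distrib, hs]
    ring
  all_goals simp [sumDiffMap, quadVec]

lemma eigenspace_splitPlusEdge_eq_bot {μ : ℝ} (h : μ ≠ 0) (h0 : μ ≠ n) (h2 : μ ≠ n + 2)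
    (h4 : μ ≠ n + 4) :
    Module.End.eigenspace (toLin' (distLapMatrix (splitPlusEdge n hn))) μ = ⊥ := by
  rw [eq_bot_iff]
  intro f hf
  obtain ⟨hS, -, -, -, hq, hu⟩ := eigenspace_splitPlusEdge_equations hn hf
  obtain ⟨e1, e2, e3⟩ := eq_of_mem_eigenspace hn h2 h4 hf
  have hS := (mul_eq_zero.1 hS).resolve_left h
  rw [hS] at hq hu
  rw [mul_zero] at hq
  have hq := (mul_eq_zero.1 hq).resolve_left (sub_ne_zero.2 h0.symm)
  rw [Submodule.mem_bot, funext_iff, forall_fin_iff hn]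
  simp only [Pi.zero_apply]
  exact ⟨by linarith, by linarith, by linarith, by linarith,
    fun u hu4 => (mul_eq_zero.1 (hu u hu4)).resolve_left (sub_ne_zero.2 h0.symm)⟩

end Spectrum

/-- The distance Laplacian spectrum of `SK_{n,4} + e` (complete split graph with independent
set of size 4 plus an edge inside that set) is `n+4` with multiplicity `2`, `n+2` with
multiplicity `1`, `n` with multiplicity `n-4`, and `0` with multiplicity `1`. -/
theorem stmt_14 (n : ℕ) (hn : 5 ≤ n)
    (M : Matrix (Fin n) (Fin n) ℝ)
    (hM : M = distLapMatrix (multipartitePlusE n (fun v => if v.val < 4 then 0 else v.val)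
      ⟨0, by omega⟩ ⟨1, by omega⟩)) :
    eigMult M ((n : ℝ) + 4) = 2 ∧
    eigMult M ((n : ℝ) + 2) = 1 ∧
    eigMult M (n : ℝ) = n - 4 ∧
    eigMult M 0 = 1 ∧
    (∀ μ : ℝ, IsEigenvalue M μ →
      μ = 0 ∨ μ = (n : ℝ) ∨ μ = (n : ℝ) + 2 ∨ μ = (n : ℝ) + 4) := by
  subst hM
  unfold eigMult IsEigenvalue
  refine ⟨?_, ?_, ?_, ?_, fun μ hμ => ?_⟩
  · rw [eigenspace_splitPlusEdge_add_four hn]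
    have hli : LinearIndependent ℝ ![quadVec n 1 1 0 (-2), quadVec n 0 0 1 (-1)] := by
      rw [LinearIndependent.pair_iff]
      intro s t hst
      have h0 := congrFun hst ⟨0, by omega⟩
      have h2 := congrFun hst ⟨2, by omega⟩
      simp [quadVec] at h0 h2
      exact ⟨h0, h2⟩
    have h := finrank_span_eq_card hli
    rwa [Matrix.range_cons_cons_empty, Fintype.card_fin] at h
  · rw [eigenspace_splitPlusEdge_add_two hn]
    apply finrank_span_singleton
    intro h
    simpa [quadVec] using congrFun h ⟨0, by omega⟩
  · rw [eigenspace_splitPlusEdge_self hn]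
    have h := (sumDiffMap hn).finrank_range_add_finrank_ker
    rw [LinearMap.range_eq_top.2 (sumDiffMap_surjective hn), finrank_top, Module.finrank_fin_fun,
      Module.finrank_fin_fun] at h
    omega
  · rw [eigenspace_splitPlusEdge_zero hn]
    apply finrank_span_singleton
    intro h
    simpa using congrFun h ⟨0, by omega⟩
  · by_contra! hne
    exact hμ (eigenspace_splitPlusEdge_eq_bot hn hne.1 hne.2.1 hne.2.2.1 hne.2.2.2)
end

section
/- Let G be a connected graph on n ≥ 5 vertices. Then n is a distance Laplacian eigenvalue of G with multiplicity n - 4 and the largest distance Laplacian eigenvalue is simple if and only if G is isomorphic to the complement of one of the following graphs: S_4 ∪ (n-4)K_1, C_4 ∪ (n-4)K_1, P_4 ∪ (n-4)K_1, Ki_{4,3} ∪ (n-4)K_1, or S_3 ∪ K_2 ∪ (n-5)K_1. -/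
open Matrix

/-- `S_4 ∪ (n-4)K_1`: star with center `0` and leaves `1,2,3`, plus isolated vertices. -/
def star4Union (n : ℕ) : SimpleGraph (Fin n) :=
  SimpleGraph.fromRel (fun u v => u.val = 0 ∧ v.val ≤ 3)

/-- `C_4 ∪ (n-4)K_1`: the 4-cycle `0-1-2-3-0` plus isolated vertices. -/
def cycle4Union (n : ℕ) : SimpleGraph (Fin n) :=
  SimpleGraph.fromRel (fun u v =>
    (u.val = 0 ∧ v.val = 1) ∨ (u.val = 1 ∧ v.val = 2) ∨
    (u.val = 2 ∧ v.val = 3) ∨ (u.val = 3 ∧ v.val = 0))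

/-- `P_4 ∪ (n-4)K_1`: the path `0-1-2-3` plus isolated vertices. -/
def path4Union (n : ℕ) : SimpleGraph (Fin n) :=
  SimpleGraph.fromRel (fun u v =>
    (u.val = 0 ∧ v.val = 1) ∨ (u.val = 1 ∧ v.val = 2) ∨ (u.val = 2 ∧ v.val = 3))

/-- `Ki_{4,3} ∪ (n-4)K_1`: the kite (triangle `0,1,2` with pendant `3` at `0`) plus
isolated vertices. -/
def kite43Union (n : ℕ) : SimpleGraph (Fin n) :=
  SimpleGraph.fromRel (fun u v =>
    (u.val = 0 ∧ v.val = 1) ∨ (u.val = 0 ∧ v.val = 2) ∨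
    (u.val = 1 ∧ v.val = 2) ∨ (u.val = 0 ∧ v.val = 3))

/-- `S_3 ∪ K_2 ∪ (n-5)K_1`: star with center `0`, leaves `1,2`; edge `3-4`;
plus isolated vertices. -/
def s3K2Union (n : ℕ) : SimpleGraph (Fin n) :=
  SimpleGraph.fromRel (fun u v =>
    (u.val = 0 ∧ (v.val = 1 ∨ v.val = 2)) ∨ (u.val = 3 ∧ v.val = 4))

open SimpleGraph in
/-- If every vertex of `T` reaches a vertex outside `T`, the vertices outside `T` meet every
component. -/
lemma card_connectedComponent_add_le {V : Type*} [Fintype V] (H : SimpleGraph V) (T : Finset V)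
    (h : ∀ v ∈ T, ∃ w, w ∉ T ∧ H.Reachable v w) :
    Nat.card H.ConnectedComponent + T.card ≤ Fintype.card V := by
  classical
  have hs : Function.Surjective
      (fun v : {v // v ∉ T} => H.connectedComponentMk v.1) := by
    intro c
    induction c using ConnectedComponent.ind with
    | h v =>
      by_cases hv : v ∈ T
      · obtain ⟨w, hw, hr⟩ := h v hv
        exact ⟨⟨w, hw⟩, ConnectedComponent.sound hr.symm⟩
      · exact ⟨⟨v, hv⟩, rfl⟩
  have h1 := Nat.card_le_card_of_surjective _ hs
  have h2 : Nat.card {v // v ∉ T} = Fintype.card V - T.card := by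
    simp [Fintype.card_subtype_compl]
  have h3 := T.card_le_univ
  omega

open SimpleGraph in
/-- If a map constant on edges fixes every vertex outside `T`, the vertices outside `T` lie in
pairwise distinct components. -/
lemma card_le_card_connectedComponent_add {V : Type*} [Fintype V] (H : SimpleGraph V)
    (T : Finset V) (f : V → V) (hf : ∀ u v, H.Adj u v → f u = f v) (hT : ∀ v, v ∉ T → f v = v) :
    Fintype.card V ≤ Nat.card H.ConnectedComponent + T.card := by
  classical
  have hr : ∀ u v, H.Reachable u v → f u = f v := by
    rintro u v ⟨p⟩
    induction p with
    | nil => rfl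
    | cons hadj _ ih => exact (hf _ _ hadj).trans ih
  have hs : Function.Injective
      (fun v : {v // v ∉ T} => H.connectedComponentMk v.1) := by
    rintro ⟨u, hu⟩ ⟨v, hv⟩ huv
    have := hr u v (ConnectedComponent.exact huv)
    rw [hT u hu, hT v hv] at this
    exact Subtype.ext this
  have h1 := Nat.card_le_card_of_injective _ hs
  have h2 : Nat.card {v // v ∉ T} = Fintype.card V - T.card := by
    simp [Fintype.card_subtype_compl]
  omega

/-- The diamond `K_4 - e`. -/
def diamondGraph : SimpleGraph (Fin 4) :=
  SimpleGraph.fromRel (fun u v => u.val = 0 ∨ (u.val = 1 ∧ (v.val = 2 ∨ v.val = 3)))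

/-- The disjoint union `K_3 ∪ K_2`. -/
def triangleUnionEdge : SimpleGraph (Fin 5) :=
  SimpleGraph.fromRel (fun u v => (u.val < 3 ∧ v.val < 3) ∨ (u.val = 3 ∧ v.val = 4))

/-- The perfect matching `3 K_2`. -/
def threeEdges : SimpleGraph (Fin 6) :=
  SimpleGraph.fromRel (fun u v => (u.val = 0 ∧ v.val = 1) ∨ (u.val = 2 ∧ v.val = 3) ∨
    (u.val = 4 ∧ v.val = 5))

/-- `H` is a copy of `K` together with isolated vertices. -/
def IsCopyWithIsolated {m : ℕ} {V : Type*} (K : SimpleGraph (Fin m)) (H : SimpleGraph V) : Prop :=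
  ∃ f : Fin m ↪ V, H = K.map f

lemma isCopyWithIsolated_of_forall {m : ℕ} {V : Type*} {K : SimpleGraph (Fin m)}
    {H : SimpleGraph V} (f : Fin m → V) (hf : Function.Injective f)
    (h : ∀ i j, H.Adj (f i) (f j) ↔ K.Adj i j) (hc : ∀ u v, H.Adj u v → ∃ i, f i = u) :
    IsCopyWithIsolated K H := by
  refine ⟨⟨f, hf⟩, ?_⟩
  ext u v
  rw [SimpleGraph.map_adj]
  constructor
  · intro huv
    obtain ⟨i, rfl⟩ := hc _ _ huv
    obtain ⟨j, rfl⟩ := hc _ _ huv.symm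
    exact ⟨i, j, (h i j).1 huv, rfl, rfl⟩
  · rintro ⟨i, j, hij, rfl, rfl⟩
    exact (h i j).2 hij

lemma isCopyWithIsolated_four {V : Type*} {K : SimpleGraph (Fin 4)} {H : SimpleGraph V}
    {a b c d : V} (hab : a ≠ b) (hac : a ≠ c) (had : a ≠ d) (hbc : b ≠ c) (hbd : b ≠ d)
    (hcd : c ≠ d) (hc : ∀ u v, H.Adj u v → u = a ∨ u = b ∨ u = c ∨ u = d)
    (h01 : H.Adj a b ↔ K.Adj 0 1) (h02 : H.Adj a c ↔ K.Adj 0 2) (h03 : H.Adj a d ↔ K.Adj 0 3)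
    (h12 : H.Adj b c ↔ K.Adj 1 2) (h13 : H.Adj b d ↔ K.Adj 1 3)
    (h23 : H.Adj c d ↔ K.Adj 2 3) : IsCopyWithIsolated K H := by
  refine isCopyWithIsolated_of_forall ![a, b, c, d] ?_ ?_ ?_
  · intro i j
    fin_cases i <;> fin_cases j <;> simp [hab, hac, had, hbc, hbd, hcd, hab.symm, hac.symm,
      had.symm, hbc.symm, hbd.symm, hcd.symm]
  · intro i j
    fin_cases i <;> fin_cases j <;>
      simp [h01, h02, h03, h12, h13, h23, H.adj_comm d, H.adj_comm c a, H.adj_comm c b,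
        H.adj_comm b a, K.adj_comm 3, K.adj_comm 2 0, K.adj_comm 2 1, K.adj_comm 1 0]
  · intro u v huv
    rcases hc u v huv with rfl | rfl | rfl | rfl
    exacts [⟨0, rfl⟩, ⟨1, rfl⟩, ⟨2, rfl⟩, ⟨3, rfl⟩]

/-- A connected set of four vertices already exhausts the edges of a graph on `n` vertices with
`n - 3` components. -/
lemma mem_of_adj_of_four_reachable {V : Type*} [Fintype V] {H : SimpleGraph V}
    (h : Nat.card H.ConnectedComponent + 3 = Fintype.card V) {a b c d : V}
    (hab : a ≠ b) (hac : a ≠ c) (had : a ≠ d) (hbc : b ≠ c) (hbd : b ≠ d) (hcd : c ≠ d)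
    (rb : H.Reachable b a) (rc : H.Reachable c a) (rd : H.Reachable d a) (u v : V)
    (huv : H.Adj u v) : u = a ∨ u = b ∨ u = c ∨ u = d := by
  classical
  by_contra! hu
  obtain ⟨hua, hub, huc, hud⟩ := hu
  have hcard : ({b, c, d, u} : Finset V).card = 4 := by
    simp [hbc, hbd, hcd, hub.symm, huc.symm, hud.symm]
  have := card_connectedComponent_add_le H {b, c, d, u} (by
    intro w hw
    have ha : a ∉ ({b, c, d, u} : Finset V) := by simp [hab, hac, had, hua.symm]
    simp only [Finset.mem_insert, Finset.mem_singleton] at hw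
    rcases hw with rfl | rfl | rfl | rfl
    · exact ⟨a, ha, rb⟩
    · exact ⟨a, ha, rc⟩
    · exact ⟨a, ha, rd⟩
    · by_cases hv : v ∈ ({b, c, d, w} : Finset V)
      · refine ⟨a, ha, huv.reachable.trans ?_⟩
        simp only [Finset.mem_insert, Finset.mem_singleton] at hv
        rcases hv with rfl | rfl | rfl | rfl
        · exact rb
        · exact rc
        · exact rd
        · exact absurd rfl huv.ne
      · exact ⟨v, hv, huv.reachable⟩)
  omega

lemma classification_of_star {V : Type*} [Fintype V] {H : SimpleGraph V}
    (h : Nat.card H.ConnectedComponent + 3 = Fintype.card V) {a b c d : V}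
    (hb : H.Adj a b) (hc : H.Adj a c) (hd : H.Adj a d)
    (hbc : b ≠ c) (hbd : b ≠ d) (hcd : c ≠ d) :
    IsCopyWithIsolated (star4Union 4) H ∨ IsCopyWithIsolated (kite43Union 4) H ∨
      IsCopyWithIsolated diamondGraph H ∨ IsCopyWithIsolated (⊤ : SimpleGraph (Fin 4)) H := by
  have hcl := mem_of_adj_of_four_reachable h hb.ne hc.ne hd.ne hbc hbd hcd
    hb.symm.reachable hc.symm.reachable hd.symm.reachable
  by_cases h1 : H.Adj b c <;> by_cases h2 : H.Adj b d <;> by_cases h3 : H.Adj c d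
  · right; right; right
    exact isCopyWithIsolated_four hb.ne hc.ne hd.ne hbc hbd hcd hcl
      (by simp [*]) (by simp [*]) (by simp [*]) (by simp [*]) (by simp [*]) (by simp [*])
  · right; right; left
    apply isCopyWithIsolated_four hb.ne hc.ne hd.ne hbc hbd hcd hcl <;>
      simp [*, diamondGraph]
  · right; right; left
    apply isCopyWithIsolated_four hc.ne hb.ne hd.ne hbc.symm hcd hbd
      (fun u v huv => by have := hcl u v huv; tauto) <;>
      simp [*, h1.symm, diamondGraph]
  · right; left
    apply isCopyWithIsolated_four hb.ne hc.ne hd.ne hbc hbd hcd hcl <;>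
      simp [*, kite43Union]
  · right; right; left
    apply isCopyWithIsolated_four hd.ne hb.ne hc.ne hbd.symm hcd.symm hbc
      (fun u v huv => by have := hcl u v huv; tauto) <;>
      simp [*, h2.symm, h3.symm, diamondGraph]
  · right; left
    apply isCopyWithIsolated_four hb.ne hd.ne hc.ne hbd hbc hcd.symm
      (fun u v huv => by have := hcl u v huv; tauto) <;>
      simp [*, H.adj_comm d c, kite43Union]
  · right; left
    apply isCopyWithIsolated_four hc.ne hd.ne hb.ne hcd hbc.symm hbd.symm
      (fun u v huv => by have := hcl u v huv; tauto) <;>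
      simp [*, H.adj_comm c b, H.adj_comm d b, kite43Union]
  · left
    apply isCopyWithIsolated_four hb.ne hc.ne hd.ne hbc hbd hcd hcl <;>
      simp [*, star4Union]

lemma classification_of_path {V : Type*} [Fintype V] {H : SimpleGraph V}
    (h : Nat.card H.ConnectedComponent + 3 = Fintype.card V)
    (hstar : ∀ a b c d, H.Adj a b → H.Adj a c → H.Adj a d → b = c ∨ b = d ∨ c = d)
    {a b c d : V} (hab : H.Adj a b) (hbc : H.Adj b c) (hcd : H.Adj c d)
    (hac : a ≠ c) (had : a ≠ d) (hbd : b ≠ d) :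
    IsCopyWithIsolated (cycle4Union 4) H ∨ IsCopyWithIsolated (path4Union 4) H := by
  have hcl := mem_of_adj_of_four_reachable h hab.ne hac had hbc.ne hbd hcd.ne
    hab.symm.reachable (hbc.symm.reachable.trans hab.symm.reachable)
    (hcd.symm.reachable.trans (hbc.symm.reachable.trans hab.symm.reachable))
  have nac : ¬ H.Adj a c := fun hh => by
    rcases hstar c a b d hh.symm hbc.symm hcd with e | e | e
    exacts [hab.ne e, had e, hbd e]
  have nbd : ¬ H.Adj b d := fun hh => by
    rcases hstar b a c d hab.symm hbc hh with e | e | e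
    exacts [hac e, had e, hcd.ne e]
  by_cases hda : H.Adj a d
  · left
    apply isCopyWithIsolated_four hab.ne hac had hbc.ne hbd hcd.ne hcl <;>
      simp [*, cycle4Union]
  · right
    apply isCopyWithIsolated_four hab.ne hac had hbc.ne hbd hcd.ne hcl <;>
      simp [*, path4Union]

lemma classification_of_path_three {V : Type*} [Fintype V] {H : SimpleGraph V}
    (h : Nat.card H.ConnectedComponent + 3 = Fintype.card V)
    (hstar : ∀ a b c d, H.Adj a b → H.Adj a c → H.Adj a d → b = c ∨ b = d ∨ c = d)
    (hpath : ∀ a b c d, H.Adj a b → H.Adj b c → H.Adj c d → a = c ∨ a = d ∨ b = d)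
    {a b c : V} (hab : H.Adj a b) (hac : H.Adj a c) (hbc : b ≠ c) :
    IsCopyWithIsolated (s3K2Union 5) H ∨ IsCopyWithIsolated triangleUnionEdge H := by
  classical
  have hcl : ∀ u v, H.Adj u v → (u = a ∨ u = b ∨ u = c) → (v = a ∨ v = b ∨ v = c) := by
    rintro u v huv (rfl | rfl | rfl)
    · rcases hstar u b c v hab hac huv with e | e | e
      · exact absurd e hbc
      · exact Or.inr (Or.inl e.symm)
      · exact Or.inr (Or.inr e.symm)
    · rcases hpath v u a c huv.symm hab.symm hac with e | e | e
      · exact Or.inl e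
      · exact Or.inr (Or.inr e)
      · exact absurd e hbc
    · rcases hpath v u a b huv.symm hac.symm hab with e | e | e
      · exact Or.inl e
      · exact Or.inr (Or.inl e)
      · exact absurd e.symm hbc
  obtain ⟨d, e, hde, hd⟩ : ∃ d e, H.Adj d e ∧ ¬ (d = a ∨ d = b ∨ d = c) := by
    by_contra! hno
    have := card_le_card_connectedComponent_add H {b, c}
      (fun v => if v = b ∨ v = c then a else v)
      (by
        intro u v huv
        have h1 := hno u v huv
        have h2 := hno v u huv.symm
        split_ifs <;> grind)
      (by intro v hv; simp_all)
    rw [Finset.card_pair hbc] at this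
    omega
  have he : ¬ (e = a ∨ e = b ∨ e = c) := fun he => hd (hcl e d hde.symm he)
  push Not at hd he
  have hout : ∀ u v, H.Adj u v → u = a ∨ u = b ∨ u = c ∨ u = d ∨ u = e := by
    intro u v huv
    by_contra! hu
    obtain ⟨hua, hub, huc, hud, hue⟩ := hu
    have hcard : ({b, c, d, u} : Finset V).card = 4 := by
      simp [hbc, hd.2.1.symm, hd.2.2.symm, hub.symm, huc.symm, hud.symm]
    have ha : a ∉ ({b, c, d, u} : Finset V) := by
      simp [hab.ne, hac.ne, hd.1.symm, hua.symm]
    have he' : e ∉ ({b, c, d, u} : Finset V) := by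
      simp [he, hde.ne.symm, hue.symm]
    have := card_connectedComponent_add_le H {b, c, d, u} (by
      intro w hw
      simp only [Finset.mem_insert, Finset.mem_singleton] at hw
      rcases hw with rfl | rfl | rfl | rfl
      · exact ⟨a, ha, hab.symm.reachable⟩
      · exact ⟨a, ha, hac.symm.reachable⟩
      · exact ⟨e, he', hde.reachable⟩
      · by_cases hv : v ∈ ({b, c, d, w} : Finset V)
        · simp only [Finset.mem_insert, Finset.mem_singleton] at hv
          rcases hv with rfl | rfl | rfl | rfl
          · exact ⟨a, ha, huv.reachable.trans hab.symm.reachable⟩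
          · exact ⟨a, ha, huv.reachable.trans hac.symm.reachable⟩
          · exact ⟨e, he', huv.reachable.trans hde.reachable⟩
          · exact absurd rfl huv.ne
        · exact ⟨v, hv, huv.reachable⟩)
    omega
  have nad : ¬ H.Adj a d := fun hh => by have := hcl a d hh (by simp); tauto
  have nae : ¬ H.Adj a e := fun hh => by have := hcl a e hh (by simp); tauto
  have nbd : ¬ H.Adj b d := fun hh => by have := hcl b d hh (by simp); tauto
  have nbe : ¬ H.Adj b e := fun hh => by have := hcl b e hh (by simp); tauto
  have ncd : ¬ H.Adj c d := fun hh => by have := hcl c d hh (by simp); tauto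
  have nce : ¬ H.Adj c e := fun hh => by have := hcl c e hh (by simp); tauto
  have hinj : Function.Injective ![a, b, c, d, e] := by
    intro i j
    fin_cases i <;> fin_cases j <;> simp [hab.ne, hac.ne, hbc, hab.ne.symm, hac.ne.symm,
      hbc.symm, hd, he, hd.1.symm, hd.2.1.symm, hd.2.2.symm, he.1.symm, he.2.1.symm,
      he.2.2.symm, hde.ne, hde.ne.symm]
  have hrange : ∀ u v, H.Adj u v → ∃ i, ![a, b, c, d, e] i = u := by
    intro u v huv
    rcases hout u v huv with rfl | rfl | rfl | rfl | rfl
    exacts [⟨0, rfl⟩, ⟨1, rfl⟩, ⟨2, rfl⟩, ⟨3, rfl⟩, ⟨4, rfl⟩]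
  by_cases hb : H.Adj b c
  · right
    refine isCopyWithIsolated_of_forall _ hinj (fun i j => ?_) hrange
    fin_cases i <;> fin_cases j <;>
      simp [triangleUnionEdge, hab, hac, hde, hb, hab.symm, hac.symm, hde.symm, hb.symm,
        nad, nae, nbd, nbe, ncd, nce, H.adj_comm d a, H.adj_comm d b, H.adj_comm d c,
        H.adj_comm e a, H.adj_comm e b, H.adj_comm e c]
  · left
    refine isCopyWithIsolated_of_forall _ hinj (fun i j => ?_) hrange
    fin_cases i <;> fin_cases j <;>
      simp [s3K2Union, hab, hac, hde, hb, hab.symm, hac.symm, hde.symm,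
        nad, nae, nbd, nbe, ncd, nce, H.adj_comm d a, H.adj_comm d b, H.adj_comm d c,
        H.adj_comm e a, H.adj_comm e b, H.adj_comm e c, H.adj_comm c b]

lemma classification_of_matching {V : Type*} [Fintype V] {H : SimpleGraph V}
    (h : Nat.card H.ConnectedComponent + 3 = Fintype.card V)
    (hm : ∀ a b c, H.Adj a b → H.Adj a c → b = c) :
    IsCopyWithIsolated threeEdges H := by
  classical
  obtain ⟨a, b, hab⟩ : ∃ a b, H.Adj a b := by
    by_contra! hno
    have := card_le_card_connectedComponent_add H ∅ id
      (fun u v huv => absurd huv (hno u v)) (by simp)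
    rw [Finset.card_empty] at this
    omega
  obtain ⟨c, d, hcd, hca, hcb⟩ : ∃ c d, H.Adj c d ∧ c ≠ a ∧ c ≠ b := by
    by_contra! hno
    have := card_le_card_connectedComponent_add H {b} (fun v => if v = b then a else v)
      (by
        intro u v huv
        have h1 := hno u v huv
        have h2 := hno v u huv.symm
        split_ifs <;> grind)
      (by intro v hv; simp_all)
    rw [Finset.card_singleton] at this
    omega
  have hda : d ≠ a := fun e => hcb (hm a c b (e ▸ hcd.symm) hab)
  have hdb : d ≠ b := fun e => hca (hm b c a (e ▸ hcd.symm) hab.symm)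
  obtain ⟨e, f, hef, hea, heb, hec, hed⟩ :
      ∃ e f, H.Adj e f ∧ e ≠ a ∧ e ≠ b ∧ e ≠ c ∧ e ≠ d := by
    by_contra! hno
    have := card_le_card_connectedComponent_add H {b, d}
      (fun v => if v = b then a else if v = d then c else v)
      (by
        intro u v huv
        have h1 : u = a ∨ u = b ∨ u = c ∨ u = d := by
          have := hno u v huv
          tauto
        have h2 : v = a ∨ v = b ∨ v = c ∨ v = d := by
          have := hno v u huv.symm
          tauto
        have hba := hab.symm
        have hdc := hcd.symm
        have hvu := huv.symm
        split_ifs <;> grind)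
      (by intro v hv; simp_all)
    have hc := Finset.card_pair hdb.symm
    omega
  have hfa : f ≠ a := fun e' => heb (hm a e b (e' ▸ hef.symm) hab)
  have hfb : f ≠ b := fun e' => hea (hm b e a (e' ▸ hef.symm) hab.symm)
  have hfc : f ≠ c := fun e' => hed (hm c e d (e' ▸ hef.symm) hcd)
  have hfd : f ≠ d := fun e' => hec (hm d e c (e' ▸ hef.symm) hcd.symm)
  have hout : ∀ u v, H.Adj u v → u = a ∨ u = b ∨ u = c ∨ u = d ∨ u = e ∨ u = f := by
    intro u v huv
    by_contra! hu
    obtain ⟨hua, hub, huc, hud, hue, huf⟩ := hu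
    have hcard : ({a, c, e, u} : Finset V).card = 4 := by
      simp [hca.symm, hea.symm, hec.symm, hua.symm, huc.symm, hue.symm]
    have := card_connectedComponent_add_le H {a, c, e, u} (by
      intro w hw
      simp only [Finset.mem_insert, Finset.mem_singleton] at hw
      rcases hw with rfl | rfl | rfl | rfl
      · exact ⟨b, by simp [hab.ne.symm, hcb.symm, heb.symm, hub.symm], hab.reachable⟩
      · exact ⟨d, by simp [hda, hcd.ne.symm, hed.symm, hud.symm], hcd.reachable⟩
      · exact ⟨f, by simp [hfa, hfc, hef.ne.symm, huf.symm], hef.reachable⟩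
      · refine ⟨v, ?_, huv.reachable⟩
        simp only [Finset.mem_insert, Finset.mem_singleton, not_or]
        refine ⟨?_, ?_, ?_, huv.ne.symm⟩
        · rintro rfl; exact hub (hm v w b huv.symm hab)
        · rintro rfl; exact hud (hm v w d huv.symm hcd)
        · rintro rfl; exact huf (hm v w f huv.symm hef))
    omega
  have key : ∀ x y z, H.Adj x y → z ≠ y → ¬ H.Adj x z := fun x y z hxy hzy hxz =>
    hzy (hm x z y hxz hxy)
  refine isCopyWithIsolated_of_forall ![a, b, c, d, e, f] ?_ ?_ ?_
  · intro i j
    fin_cases i <;> fin_cases j <;> simp [hab.ne, hab.ne.symm, hcd.ne, hcd.ne.symm, hef.ne,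
      hef.ne.symm, hca, hca.symm, hcb, hcb.symm, hda, hda.symm, hdb, hdb.symm, hea, hea.symm,
      heb, heb.symm, hec, hec.symm, hed, hed.symm, hfa, hfa.symm, hfb, hfb.symm, hfc, hfc.symm,
      hfd, hfd.symm]
  · intro i j
    fin_cases i <;> fin_cases j <;> simp [threeEdges, hab, hab.symm, hcd, hcd.symm, hef,
      hef.symm, key a b _ hab, key b a _ hab.symm, key c d _ hcd, key d c _ hcd.symm,
      key e f _ hef, key f e _ hef.symm, hca, hca.symm, hcb, hcb.symm, hda, hda.symm,
      hdb, hdb.symm, hea, hea.symm, heb, heb.symm, hec, hec.symm, hed, hed.symm, hfa, hfa.symm,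
      hfb, hfb.symm, hfc, hfc.symm, hfd, hfd.symm]
  · intro u v huv
    rcases hout u v huv with rfl | rfl | rfl | rfl | rfl | rfl
    exacts [⟨0, rfl⟩, ⟨1, rfl⟩, ⟨2, rfl⟩, ⟨3, rfl⟩, ⟨4, rfl⟩, ⟨5, rfl⟩]

/-- The graphs on `n` vertices with `n - 3` connected components. -/
lemma classification_of_card_connectedComponent {V : Type*} [Fintype V] {H : SimpleGraph V}
    (h : Nat.card H.ConnectedComponent + 3 = Fintype.card V) :
    (IsCopyWithIsolated (star4Union 4) H ∨ IsCopyWithIsolated (cycle4Union 4) H ∨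
      IsCopyWithIsolated (path4Union 4) H ∨ IsCopyWithIsolated (kite43Union 4) H ∨
      IsCopyWithIsolated (s3K2Union 5) H) ∨
    IsCopyWithIsolated diamondGraph H ∨ IsCopyWithIsolated (⊤ : SimpleGraph (Fin 4)) H ∨
      IsCopyWithIsolated triangleUnionEdge H ∨ IsCopyWithIsolated threeEdges H := by
  by_cases hstar : ∀ a b c d, H.Adj a b → H.Adj a c → H.Adj a d → b = c ∨ b = d ∨ c = d
  · by_cases hpath : ∀ a b c d, H.Adj a b → H.Adj b c → H.Adj c d → a = c ∨ a = d ∨ b = d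
    · by_cases hm : ∀ a b c, H.Adj a b → H.Adj a c → b = c
      · have := classification_of_matching h hm
        tauto
      · push Not at hm
        obtain ⟨a, b, c, hab, hac, hbc⟩ := hm
        have := classification_of_path_three h hstar hpath hab hac hbc
        tauto
    · push Not at hpath
      obtain ⟨a, b, c, d, hab, hbc, hcd, hac, had, hbd⟩ := hpath
      have := classification_of_path h hstar hab hbc hcd hac had hbd
      tauto
  · push Not at hstar
    obtain ⟨a, b, c, d, hb, hc, hd, hbc, hbd, hcd⟩ := hstar
    have := classification_of_star h hb hc hd hbc hbd hcd
    tauto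

/-- A copy of a graph on `m` vertices with isolated vertices has as many components as a
retraction of the pattern onto `m - 3` vertices along edges dictates. -/
lemma card_connectedComponent_of_isCopyWithIsolated {m : ℕ} {V : Type*} [Fintype V]
    {K : SimpleGraph (Fin m)} {H : SimpleGraph V} (hH : IsCopyWithIsolated K H)
    (T : Finset (Fin m)) (r : Fin m → Fin m) (hr : ∀ i j, K.Adj i j → r i = r j)
    (hT : ∀ i, i ∉ T → r i = i) (hT' : ∀ i ∈ T, ∃ j, j ∉ T ∧ K.Reachable i j) :
    Nat.card H.ConnectedComponent + T.card = Fintype.card V := by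
  classical
  obtain ⟨f, rfl⟩ := hH
  apply le_antisymm
  · rw [← Finset.card_map f]
    apply card_connectedComponent_add_le
    intro v hv
    obtain ⟨i, hi, rfl⟩ := Finset.mem_map.1 hv
    obtain ⟨j, hj, hij⟩ := hT' i hi
    refine ⟨f j, by simpa using hj, ?_⟩
    exact hij.map (SimpleGraph.Embedding.map f K).toHom
  · rw [← Finset.card_map f]
    apply card_le_card_connectedComponent_add _ _ (Function.extend f (f ∘ r) id)
    · intro u v huv
      rw [SimpleGraph.map_adj] at huv
      obtain ⟨i, j, hij, rfl, rfl⟩ := huv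
      rw [f.injective.extend_apply, f.injective.extend_apply, Function.comp, Function.comp,
        hr i j hij]
    · intro v hv
      by_cases hx : ∃ i, f i = v
      · obtain ⟨i, rfl⟩ := hx
        rw [f.injective.extend_apply, Function.comp, hT i (by simpa using hv)]
      · rw [Function.extend_apply' _ _ _ hx, id]

lemma card_connectedComponent_of_pattern {V : Type*} [Fintype V] {H : SimpleGraph V}
    (h : IsCopyWithIsolated (star4Union 4) H ∨ IsCopyWithIsolated (cycle4Union 4) H ∨
      IsCopyWithIsolated (path4Union 4) H ∨ IsCopyWithIsolated (kite43Union 4) H ∨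
      IsCopyWithIsolated (s3K2Union 5) H) :
    Nat.card H.ConnectedComponent + 3 = Fintype.card V := by
  have four : ∀ K : SimpleGraph (Fin 4), K.Adj 0 1 → K.Reachable 0 2 → K.Reachable 0 3 →
      IsCopyWithIsolated K H → Nat.card H.ConnectedComponent + 3 = Fintype.card V := by
    intro K h1 h2 h3 hK
    refine card_connectedComponent_of_isCopyWithIsolated hK {1, 2, 3} (fun _ => 0)
      (fun _ _ _ => rfl) (by decide) ?_
    intro i hi
    refine ⟨0, by decide, ?_⟩
    fin_cases i
    · simp at hi
    exacts [h1.symm.reachable, h2.symm, h3.symm]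
  rcases h with h | h | h | h | h
  · refine four _ ?_ (SimpleGraph.Adj.reachable ?_) (SimpleGraph.Adj.reachable ?_) h <;>
      simp [star4Union]
  · refine four _ ?_ ((SimpleGraph.Adj.reachable (v := 1) ?_).trans
      (SimpleGraph.Adj.reachable ?_)) (SimpleGraph.Adj.reachable ?_) h <;> simp [cycle4Union]
  · refine four _ ?_ ((SimpleGraph.Adj.reachable (v := 1) ?_).trans
      (SimpleGraph.Adj.reachable ?_)) ((SimpleGraph.Adj.reachable (v := 1) ?_).trans
      ((SimpleGraph.Adj.reachable (v := 2) ?_).trans (SimpleGraph.Adj.reachable ?_))) h <;>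
      simp [path4Union]
  · refine four _ ?_ (SimpleGraph.Adj.reachable ?_) (SimpleGraph.Adj.reachable ?_) h <;>
      simp [kite43Union]
  · refine card_connectedComponent_of_isCopyWithIsolated h {1, 2, 4} ![0, 0, 0, 3, 3]
      ?_ (by decide) ?_
    · intro i j
      fin_cases i <;> fin_cases j <;> simp [s3K2Union]
    · intro i hi
      fin_cases i
      · simp at hi
      · exact ⟨0, by decide, SimpleGraph.Adj.reachable (by simp [s3K2Union])⟩
      · exact ⟨0, by decide, SimpleGraph.Adj.reachable (by simp [s3K2Union])⟩
      · simp at hi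
      · exact ⟨3, by decide, SimpleGraph.Adj.reachable (by simp [s3K2Union])⟩

/-- Isomorphism to the complement of `K ∪ (n - m) K_1`, in terms of the complement graph. -/
lemma nonempty_iso_compl_iff {m n : ℕ} (hmn : m ≤ n) (K : SimpleGraph (Fin m))
    (Kn G : SimpleGraph (Fin n)) (hK : Kn = K.map (Fin.castLEEmb hmn)) :
    Nonempty (G ≃g Knᶜ) ↔ IsCopyWithIsolated K Gᶜ := by
  subst hK
  constructor
  · rintro ⟨φ⟩
    have key : ∀ u v, Gᶜ.Adj u v ↔ (K.map (Fin.castLEEmb hmn)).Adj (φ u) (φ v) := by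
      intro u v
      have hne := (K.map (Fin.castLEEmb hmn)).ne_of_adj (a := φ u) (b := φ v)
      rw [SimpleGraph.compl_adj, ← φ.map_adj_iff, SimpleGraph.compl_adj, ne_eq, ne_eq,
        φ.injective.eq_iff] at *
      tauto
    refine isCopyWithIsolated_of_forall (fun i => φ.symm (Fin.castLEEmb hmn i))
      (φ.symm.injective.comp (Fin.castLEEmb hmn).injective) ?_ ?_
    · intro i j
      rw [key, φ.apply_symm_apply, φ.apply_symm_apply, SimpleGraph.map_adj_apply]
    · intro u v huv
      rw [key, SimpleGraph.map_adj] at huv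
      obtain ⟨i, j, -, hi, -⟩ := huv
      exact ⟨i, by rw [hi, φ.symm_apply_apply]⟩
  · rintro ⟨f, hf⟩
    obtain ⟨σ, hσ⟩ := Equiv.Perm.exists_extending_pair f (Fin.castLEEmb hmn) f.injective
      (Fin.castLEEmb hmn).injective
    have key : ∀ u v, (K.map (Fin.castLEEmb hmn)).Adj (σ u) (σ v) ↔ Gᶜ.Adj u v := by
      intro u v
      simp only [hf, SimpleGraph.map_adj, ← hσ, σ.injective.eq_iff]
    refine ⟨σ, fun {u v} => ?_⟩
    rw [SimpleGraph.compl_adj, key, SimpleGraph.compl_adj, ne_eq, σ.injective.eq_iff]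
    have := G.ne_of_adj (a := u) (b := v)
    tauto

lemma star4Union_eq_map {n : ℕ} (hn : 4 ≤ n) :
    star4Union n = (star4Union 4).map (Fin.castLEEmb hn) := by
  ext u v
  simp only [star4Union, SimpleGraph.fromRel_adj, SimpleGraph.map_adj, Fin.castLEEmb_apply,
    Fin.ext_iff, Fin.val_castLE, ne_eq]
  constructor
  · intro h
    exact ⟨⟨u, by omega⟩, ⟨v, by omega⟩, by simpa using h, rfl, rfl⟩
  · rintro ⟨i, j, h, hi, hj⟩
    rwa [hi, hj] at h

lemma cycle4Union_eq_map {n : ℕ} (hn : 4 ≤ n) :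
    cycle4Union n = (cycle4Union 4).map (Fin.castLEEmb hn) := by
  ext u v
  simp only [cycle4Union, SimpleGraph.fromRel_adj, SimpleGraph.map_adj, Fin.castLEEmb_apply,
    Fin.ext_iff, Fin.val_castLE, ne_eq]
  constructor
  · intro h
    exact ⟨⟨u, by omega⟩, ⟨v, by omega⟩, by simpa using h, rfl, rfl⟩
  · rintro ⟨i, j, h, hi, hj⟩
    rwa [hi, hj] at h

lemma path4Union_eq_map {n : ℕ} (hn : 4 ≤ n) :
    path4Union n = (path4Union 4).map (Fin.castLEEmb hn) := by
  ext u v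
  simp only [path4Union, SimpleGraph.fromRel_adj, SimpleGraph.map_adj, Fin.castLEEmb_apply,
    Fin.ext_iff, Fin.val_castLE, ne_eq]
  constructor
  · intro h
    exact ⟨⟨u, by omega⟩, ⟨v, by omega⟩, by simpa using h, rfl, rfl⟩
  · rintro ⟨i, j, h, hi, hj⟩
    rwa [hi, hj] at h

lemma kite43Union_eq_map {n : ℕ} (hn : 4 ≤ n) :
    kite43Union n = (kite43Union 4).map (Fin.castLEEmb hn) := by
  ext u v
  simp only [kite43Union, SimpleGraph.fromRel_adj, SimpleGraph.map_adj, Fin.castLEEmb_apply,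
    Fin.ext_iff, Fin.val_castLE, ne_eq]
  constructor
  · intro h
    exact ⟨⟨u, by omega⟩, ⟨v, by omega⟩, by simpa using h, rfl, rfl⟩
  · rintro ⟨i, j, h, hi, hj⟩
    rwa [hi, hj] at h

lemma s3K2Union_eq_map {n : ℕ} (hn : 5 ≤ n) :
    s3K2Union n = (s3K2Union 5).map (Fin.castLEEmb hn) := by
  ext u v
  simp only [s3K2Union, SimpleGraph.fromRel_adj, SimpleGraph.map_adj, Fin.castLEEmb_apply,
    Fin.ext_iff, Fin.val_castLE, ne_eq]
  constructor
  · intro h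
    exact ⟨⟨u, by omega⟩, ⟨v, by omega⟩, by simpa using h, rfl, rfl⟩
  · rintro ⟨i, j, h, hi, hj⟩
    rwa [hi, hj] at h

lemma distLapMatrix_mulVec_apply {V : Type*} [Fintype V] [DecidableEq V] (G : SimpleGraph V)
    (x : V → ℝ) (v : V) :
    (distLapMatrix G).mulVec x v = ∑ u, (G.dist v u : ℝ) * (x v - x u) := by
  have h : ∀ u, distLapMatrix G v u * x u =
      (if v = u then (transmission G v : ℝ) * x v else 0) - (G.dist v u : ℝ) * x u := by
    intro u
    unfold distLapMatrix
    split_ifs with huv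
    · subst huv
      simp
    · ring
  simp only [Matrix.mulVec, dotProduct, h, mul_sub, Finset.sum_sub_distrib, Finset.sum_ite_eq,
    Finset.mem_univ, if_true]
  rw [← Finset.sum_mul, transmission, Nat.cast_sum]

lemma sum_sum_mul_sub_eq_zero {V : Type*} [Fintype V] (w : V → V → ℝ)
    (hw : ∀ u v, w u v = w v u) (x : V → ℝ) : ∑ v, ∑ u, w v u * (x v - x u) = 0 := by
  have h : ∑ v, ∑ u, w v u * (x v - x u) = -∑ v, ∑ u, w v u * (x v - x u) := by
    conv_rhs => rw [Finset.sum_comm]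
    simp only [← Finset.sum_neg_distrib]
    refine Finset.sum_congr rfl fun v _ => Finset.sum_congr rfl fun u _ => ?_
    rw [hw u v]
    ring
  linarith

lemma sum_sum_mul_sub_sq {V : Type*} [Fintype V] (w : V → V → ℝ)
    (hw : ∀ u v, w u v = w v u) (x : V → ℝ) :
    ∑ v, ∑ u, w v u * (x v - x u) ^ 2 = 2 * ∑ v, x v * ∑ u, w v u * (x v - x u) := by
  have h1 : ∑ v, ∑ u, w v u * (x v - x u) ^ 2 =
      ∑ v, ∑ u, w v u * (x v * (x v - x u)) + ∑ v, ∑ u, w v u * (x u * (x u - x v)) := by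
    simp only [← Finset.sum_add_distrib]
    refine Finset.sum_congr rfl fun v _ => Finset.sum_congr rfl fun u _ => ?_
    ring
  have h2 : ∑ v, ∑ u, w v u * (x u * (x u - x v)) = ∑ v, ∑ u, w v u * (x v * (x v - x u)) := by
    rw [Finset.sum_comm]
    refine Finset.sum_congr rfl fun v _ => Finset.sum_congr rfl fun u _ => ?_
    rw [hw]
  rw [h1, h2, ← two_mul]
  congr 1
  refine Finset.sum_congr rfl fun v _ => ?_
  rw [Finset.mul_sum]
  refine Finset.sum_congr rfl fun u _ => ?_
  ring

lemma mem_eigenspace_distLapMatrix {V : Type*} [Fintype V] [DecidableEq V] {G : SimpleGraph V}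
    {μ : ℝ} {x : V → ℝ} :
    x ∈ Module.End.eigenspace (Matrix.toLin' (distLapMatrix G)) μ ↔
      ∀ v, ∑ u, (G.dist v u : ℝ) * (x v - x u) = μ * x v := by
  rw [Module.End.mem_eigenspace_iff, Matrix.toLin'_apply, funext_iff]
  simp only [distLapMatrix_mulVec_apply, Pi.smul_apply, smul_eq_mul]

lemma sum_eq_zero_of_mem_eigenspace {V : Type*} [Fintype V] [DecidableEq V] {G : SimpleGraph V}
    {μ : ℝ} (hμ : μ ≠ 0) {x : V → ℝ}
    (hx : x ∈ Module.End.eigenspace (Matrix.toLin' (distLapMatrix G)) μ) : ∑ v, x v = 0 := by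
  rw [mem_eigenspace_distLapMatrix] at hx
  have h := sum_sum_mul_sub_eq_zero (fun u v => (G.dist u v : ℝ))
    (fun u v => by rw [SimpleGraph.dist_comm]) x
  simp only [hx, ← Finset.mul_sum] at h
  exact (mul_eq_zero.1 h).resolve_left hμ

lemma sum_const_sub {V : Type*} [Fintype V] (x : V → ℝ) (v : V) :
    ∑ u, (x v - x u) = Fintype.card V * x v - ∑ u, x u := by
  rw [Finset.sum_sub_distrib, Finset.sum_const, Finset.card_univ, nsmul_eq_mul]

/-- The eigenspace of the distance Laplacian for the eigenvalue `|V|` consists of the vectors of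
sum zero that are constant on the components of the complement. -/
lemma mem_eigenspace_card_iff {V : Type*} [Fintype V] [DecidableEq V] [Nonempty V]
    {G : SimpleGraph V} (hG : G.Connected) {x : V → ℝ} :
    x ∈ Module.End.eigenspace (Matrix.toLin' (distLapMatrix G)) (Fintype.card V : ℝ) ↔
      (∀ u v, Gᶜ.Adj u v → x u = x v) ∧ ∑ v, x v = 0 := by
  constructor
  · intro hx
    have hsum := sum_eq_zero_of_mem_eigenspace (by positivity) hx
    refine ⟨?_, hsum⟩
    rw [mem_eigenspace_distLapMatrix] at hx
    have hz := sum_sum_mul_sub_sq (fun u v => (G.dist u v : ℝ) - 1)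
      (fun u v => by rw [SimpleGraph.dist_comm]) x
    have hin : ∀ v, ∑ u, ((G.dist v u : ℝ) - 1) * (x v - x u) = 0 := by
      intro v
      simp only [sub_mul, one_mul, Finset.sum_sub_distrib (f := fun u => _ * (x v - x u))]
      rw [hx, sum_const_sub, hsum]
      ring
    simp only [hin, mul_zero, Finset.sum_const_zero] at hz
    have hnn : ∀ v u, 0 ≤ ((G.dist v u : ℝ) - 1) * (x v - x u) ^ 2 := by
      intro v u
      by_cases huv : v = u
      · simp [huv]
      · have : (1 : ℝ) ≤ G.dist v u := by exact_mod_cast hG.pos_dist_of_ne huv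
        have : 0 ≤ (G.dist v u : ℝ) - 1 := by linarith
        positivity
    intro u v huv
    rw [SimpleGraph.compl_adj] at huv
    have h0 := (Finset.sum_eq_zero_iff_of_nonneg
      (fun v _ => Finset.sum_nonneg fun u _ => hnn v u)).1 hz u (Finset.mem_univ _)
    have h1 := (Finset.sum_eq_zero_iff_of_nonneg (fun v _ => hnn u v)).1 h0 v (Finset.mem_univ _)
    rcases mul_eq_zero.1 h1 with h2 | h2
    · refine absurd (SimpleGraph.dist_eq_one_iff_adj.1 ?_) huv.2
      exact_mod_cast sub_eq_zero.1 h2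
    · exact sub_eq_zero.1 (pow_eq_zero_iff two_ne_zero |>.1 h2)
  · rintro ⟨hx, hsum⟩
    rw [mem_eigenspace_distLapMatrix]
    intro v
    rw [← sub_zero (_ * x v), ← hsum, ← sum_const_sub]
    refine Finset.sum_congr rfl fun u _ => ?_
    by_cases huv : v = u
    · simp [huv]
    by_cases hadj : G.Adj v u
    · rw [SimpleGraph.dist_eq_one_iff_adj.2 hadj, Nat.cast_one, one_mul]
    · rw [hx v u (by simp [huv, hadj]), sub_self, mul_zero]

lemma eigMult_card_add_one {V : Type*} [Fintype V] [DecidableEq V] [Nonempty V]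
    {G : SimpleGraph V} (hG : G.Connected) :
    eigMult (distLapMatrix G) (Fintype.card V : ℝ) + 1 = Nat.card Gᶜ.ConnectedComponent := by
  classical
  set K := (Matrix.toLin' (Gᶜ.lapMatrix ℝ)).ker with hK
  have hmem : ∀ x, x ∈ K ↔ ∀ u v, Gᶜ.Adj u v → x u = x v := by
    intro x
    rw [hK, LinearMap.mem_ker, Matrix.toLin'_apply,
      SimpleGraph.lapMatrix_mulVec_eq_zero_iff_forall_adj]
  let φ : K →ₗ[ℝ] ℝ := (∑ v, LinearMap.proj v : (V → ℝ) →ₗ[ℝ] ℝ).comp K.subtype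
  have hφ : ∀ x : K, φ x = ∑ v, x.1 v := by
    intro x
    simp [φ]
  have hrange : φ.range = ⊤ := by
    rw [LinearMap.range_eq_top]
    apply LinearMap.surjective
    intro h
    have h1 := hφ ⟨fun _ => 1, (hmem _).2 fun _ _ _ => rfl⟩
    rw [h] at h1
    simp [eq_comm, Fintype.card_ne_zero] at h1
  have hdim := LinearMap.finrank_range_add_finrank_ker φ
  rw [hrange, finrank_top, Module.finrank_self] at hdim
  have hmap : Module.End.eigenspace (Matrix.toLin' (distLapMatrix G)) (Fintype.card V : ℝ) =
      φ.ker.map K.subtype := by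
    ext x
    rw [mem_eigenspace_card_iff hG, ← hmem]
    simp only [Submodule.mem_map, LinearMap.mem_ker, hφ, Submodule.subtype_apply]
    constructor
    · rintro ⟨h1, h2⟩
      exact ⟨⟨x, h1⟩, h2, rfl⟩
    · rintro ⟨y, h1, rfl⟩
      exact ⟨y.2, h1⟩
  rw [eigMult, hmap, Submodule.finrank_map_subtype_eq, Nat.card_eq_fintype_card,
    SimpleGraph.card_connectedComponent_eq_finrank_ker_toLin'_lapMatrix, ← hdim, add_comm]

open Classical in
/-- The eigenspace of the Laplacian of `H` for the eigenvalue `l`. -/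
noncomputable def lapEigenspace {V : Type*} [Fintype V] (H : SimpleGraph V) (l : ℝ) :
    Submodule ℝ (V → ℝ) where
  carrier := {x | ∀ v, ∑ u, (if H.Adj v u then x v - x u else 0) = l * x v}
  add_mem' := by
    intro x y hx hy v
    rw [Pi.add_apply, mul_add, ← hx v, ← hy v, ← Finset.sum_add_distrib]
    refine Finset.sum_congr rfl fun u _ => ?_
    split_ifs
    · simp only [Pi.add_apply]
      ring
    · simp
  zero_mem' := by
    intro v
    simp
  smul_mem' := by
    intro c x hx v
    rw [Pi.smul_apply, smul_eq_mul, mul_left_comm, ← hx v, Finset.mul_sum]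
    refine Finset.sum_congr rfl fun u _ => ?_
    split_ifs
    · simp only [Pi.smul_apply, smul_eq_mul]
      ring
    · simp

lemma mem_lapEigenspace {V : Type*} [Fintype V] {H : SimpleGraph V} [DecidableRel H.Adj] {l : ℝ}
    {x : V → ℝ} :
    x ∈ lapEigenspace H l ↔ ∀ v, ∑ u, (if H.Adj v u then x v - x u else 0) = l * x v := by
  refine Iff.trans Iff.rfl (forall_congr' fun v => ?_)
  congr!

lemma dist_eq_two_of_compl_adj {V : Type*} [Finite V] {G : SimpleGraph V}
    (hc : 2 ≤ Nat.card Gᶜ.ConnectedComponent) {u v : V} (huv : Gᶜ.Adj u v) :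
    G.dist u v = 2 := by
  obtain ⟨c, hne⟩ : ∃ c, c ≠ Gᶜ.connectedComponentMk u := by
    have : Nontrivial Gᶜ.ConnectedComponent := Finite.one_lt_card_iff_nontrivial.1 hc
    exact exists_ne _
  induction c using SimpleGraph.ConnectedComponent.ind with
  | h w =>
    have hwu : ¬ Gᶜ.Adj w u := fun h =>
      hne (SimpleGraph.ConnectedComponent.sound h.reachable)
    have hwv : ¬ Gᶜ.Adj w v := fun h =>
      hne (SimpleGraph.ConnectedComponent.sound (h.reachable.trans huv.symm.reachable))
    have h1 : w ≠ u := by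
      rintro rfl
      exact hne rfl
    have h2 : w ≠ v := by
      rintro rfl
      exact hwu huv.symm
    rw [SimpleGraph.compl_adj] at huv hwu hwv
    have a1 : G.Adj w u := by tauto
    have a2 : G.Adj w v := by tauto
    have hle := SimpleGraph.dist_le (SimpleGraph.Walk.cons a1.symm a2.toWalk)
    have hn1 := mt SimpleGraph.dist_eq_one_iff_adj.1 huv.2
    have hpos := (a1.symm.reachable.trans a2.reachable).pos_dist_of_ne huv.1
    simp only [SimpleGraph.Walk.length_cons, SimpleGraph.Walk.length_nil] at hle
    omega

lemma sum_dist_mul_sub {V : Type*} [Fintype V] {G : SimpleGraph V} [DecidableRel Gᶜ.Adj]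
    (hc : 2 ≤ Nat.card Gᶜ.ConnectedComponent) (x : V → ℝ) (v : V) :
    ∑ u, (G.dist v u : ℝ) * (x v - x u) = Fintype.card V * x v - ∑ u, x u +
      ∑ u, (if Gᶜ.Adj v u then x v - x u else 0) := by
  rw [← sum_const_sub, ← Finset.sum_add_distrib]
  refine Finset.sum_congr rfl fun u _ => ?_
  by_cases huv : v = u
  · simp [huv]
  split_ifs with h
  · rw [dist_eq_two_of_compl_adj hc h]
    push_cast
    ring
  · have : G.Adj v u := by
      rw [SimpleGraph.compl_adj] at h
      tauto
    rw [SimpleGraph.dist_eq_one_iff_adj.2 this]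
    simp

lemma sum_eq_zero_of_mem_lapEigenspace {V : Type*} [Fintype V] {H : SimpleGraph V} {l : ℝ}
    (hl : l ≠ 0) {x : V → ℝ} (hx : x ∈ lapEigenspace H l) : ∑ v, x v = 0 := by
  classical
  have h := sum_sum_mul_sub_eq_zero (fun u v => if H.Adj u v then (1 : ℝ) else 0)
    (fun u v => by simp only [H.adj_comm]) x
  rw [mem_lapEigenspace] at hx
  simp only [ite_mul, one_mul, zero_mul] at h
  have h2 : ∑ v, l * x v = 0 := by
    rw [← h]
    refine Finset.sum_congr rfl fun v _ => ?_
    rw [← hx]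
  rw [← Finset.mul_sum] at h2
  exact (mul_eq_zero.1 h2).resolve_left hl

lemma eigenspace_distLapMatrix_eq_lapEigenspace {V : Type*} [Fintype V] [DecidableEq V]
    {G : SimpleGraph V} (hc : 2 ≤ Nat.card Gᶜ.ConnectedComponent) {l : ℝ} (hl : 0 < l) :
    Module.End.eigenspace (Matrix.toLin' (distLapMatrix G)) (Fintype.card V + l) =
      lapEigenspace Gᶜ l := by
  classical
  ext x
  constructor
  · intro hx
    have hsum := sum_eq_zero_of_mem_eigenspace (by positivity) hx
    rw [mem_eigenspace_distLapMatrix] at hx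
    rw [mem_lapEigenspace]
    intro v
    have h1 := hx v
    rw [sum_dist_mul_sub hc, hsum] at h1
    linarith
  · intro hx
    have hsum := sum_eq_zero_of_mem_lapEigenspace hl.ne' hx
    rw [mem_eigenspace_distLapMatrix]
    rw [mem_lapEigenspace] at hx
    intro v
    rw [sum_dist_mul_sub hc, hsum, hx]
    ring

/-- `t` is the largest eigenvalue of the Laplacian of `H`, and it is positive. -/
def IsTopLapEigenvalue {V : Type*} [Fintype V] (H : SimpleGraph V) (t : ℝ) : Prop :=
  0 < t ∧ (∀ l, t < l → lapEigenspace H l = ⊥) ∧ lapEigenspace H t ≠ ⊥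

lemma largest_simple_iff {V : Type*} [Fintype V] [DecidableEq V]
    {G : SimpleGraph V} (hc : 2 ≤ Nat.card Gᶜ.ConnectedComponent) {t : ℝ}
    (ht : IsTopLapEigenvalue Gᶜ t) :
    (∃ μ : ℝ, IsEigenvalue (distLapMatrix G) μ ∧
      (∀ ν : ℝ, IsEigenvalue (distLapMatrix G) ν → ν ≤ μ) ∧ eigMult (distLapMatrix G) μ = 1) ↔
      Module.finrank ℝ (lapEigenspace Gᶜ t) = 1 := by
  obtain ⟨h0, hmax, hne⟩ := ht
  have hev : IsEigenvalue (distLapMatrix G) (Fintype.card V + t) := by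
    rw [IsEigenvalue, Module.End.hasEigenvalue_iff,
      eigenspace_distLapMatrix_eq_lapEigenspace hc h0]
    exact hne
  have hub : ∀ ν, IsEigenvalue (distLapMatrix G) ν → ν ≤ Fintype.card V + t := by
    intro ν hν
    by_contra! hlt
    rw [IsEigenvalue, Module.End.hasEigenvalue_iff] at hν
    apply hν
    rw [← add_sub_cancel (Fintype.card V : ℝ) ν,
      eigenspace_distLapMatrix_eq_lapEigenspace hc (by linarith)]
    exact hmax _ (by linarith)
  constructor
  · rintro ⟨μ, hμ, hle, hm⟩
    have : μ = Fintype.card V + t := le_antisymm (hub μ hμ) (hle _ hev)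
    rwa [this, eigMult, eigenspace_distLapMatrix_eq_lapEigenspace hc h0] at hm
  · intro h
    refine ⟨_, hev, hub, ?_⟩
    rwa [eigMult, eigenspace_distLapMatrix_eq_lapEigenspace hc h0]

/-- Extension by zero identifies the Laplacian eigenspaces for nonzero eigenvalues. -/
lemma lapEigenspace_map {m : ℕ} {V : Type*} [Fintype V] (K : SimpleGraph (Fin m))
    (f : Fin m ↪ V) {l : ℝ} (hl : l ≠ 0) :
    lapEigenspace (K.map f) l =
      (lapEigenspace K l).map (Function.ExtendByZero.linearMap ℝ f) := by
  classical
  have hsum : ∀ (x : V → ℝ) i, ∑ u, (if (K.map f).Adj (f i) u then x (f i) - x u else 0) =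
      ∑ j, (if K.Adj i j then x (f i) - x (f j) else 0) := by
    intro x i
    symm
    apply Fintype.sum_of_injective f f.injective
    · intro u hu
      rw [if_neg]
      rw [SimpleGraph.map_adj]
      rintro ⟨_, j, -, -, rfl⟩
      exact hu ⟨j, rfl⟩
    · intro j
      simp only [SimpleGraph.map_adj_apply]
  have hout : ∀ (x : V → ℝ) v, (¬ ∃ i, f i = v) →
      ∑ u, (if (K.map f).Adj v u then x v - x u else 0) = 0 := by
    intro x v hv
    refine Finset.sum_eq_zero fun u _ => if_neg ?_
    rw [SimpleGraph.map_adj]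
    rintro ⟨i, _, -, hi, -⟩
    exact hv ⟨i, hi⟩
  ext x
  rw [Submodule.mem_map]
  constructor
  · intro hx
    rw [mem_lapEigenspace] at hx
    refine ⟨x ∘ f, ?_, ?_⟩
    · rw [mem_lapEigenspace]
      intro i
      have := hx (f i)
      simp only [Function.comp]
      rw [← this, hsum]
    · ext v
      rw [Function.ExtendByZero.linearMap_apply]
      by_cases hv : ∃ i, f i = v
      · obtain ⟨i, rfl⟩ := hv
        rw [f.injective.extend_apply, Function.comp]
      · rw [Function.extend_apply' _ _ _ hv, Pi.zero_apply]
        have h1 := hx v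
        rw [hout x v hv] at h1
        exact ((mul_eq_zero.1 h1.symm).resolve_left hl).symm
  · rintro ⟨y, hy, rfl⟩
    rw [mem_lapEigenspace] at hy ⊢
    intro v
    by_cases hv : ∃ i, f i = v
    · obtain ⟨i, rfl⟩ := hv
      have h1 := hsum (Function.ExtendByZero.linearMap ℝ f y) i
      simp only [Function.ExtendByZero.linearMap_apply, f.injective.extend_apply] at h1 ⊢
      rw [← hy i, h1]
    · have h1 := hout (Function.ExtendByZero.linearMap ℝ f y) v hv
      have h2 : Function.ExtendByZero.linearMap ℝ f y v = 0 := by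
        rw [Function.ExtendByZero.linearMap_apply, Function.extend_apply' _ _ _ hv, Pi.zero_apply]
      rw [h1, h2, mul_zero]

lemma extendByZero_injective {m : ℕ} {V : Type*} (f : Fin m ↪ V) :
    Function.Injective (Function.ExtendByZero.linearMap ℝ f) := by
  intro x y hxy
  ext i
  have := congrFun hxy (f i)
  simpa only [Function.ExtendByZero.linearMap_apply, f.injective.extend_apply] using this

lemma finrank_lapEigenspace_map {m : ℕ} {V : Type*} [Fintype V] (K : SimpleGraph (Fin m))
    (f : Fin m ↪ V) {l : ℝ} (hl : l ≠ 0) :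
    Module.finrank ℝ (lapEigenspace (K.map f) l) = Module.finrank ℝ (lapEigenspace K l) := by
  rw [lapEigenspace_map K f hl]
  exact (Submodule.equivMapOfInjective _ (extendByZero_injective f) _).symm.finrank_eq

lemma IsTopLapEigenvalue.map {m : ℕ} {V : Type*} [Fintype V] {K : SimpleGraph (Fin m)}
    {t : ℝ} (h : IsTopLapEigenvalue K t) (f : Fin m ↪ V) : IsTopLapEigenvalue (K.map f) t := by
  obtain ⟨h0, hmax, hne⟩ := h
  refine ⟨h0, fun l hl => ?_, ?_⟩
  · rw [lapEigenspace_map K f (by linarith), hmax l hl, Submodule.map_bot]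
  · rw [lapEigenspace_map K f h0.ne']
    exact fun h => hne (Submodule.map_injective_of_injective (extendByZero_injective f)
      (h.trans (Submodule.map_bot _).symm))

lemma finrank_lapEigenspace_eq_one {V : Type*} [Fintype V] {H : SimpleGraph V} {t : ℝ}
    {y : V → ℝ} (hy : y ∈ lapEigenspace H t) (hy0 : y ≠ 0)
    (h : ∀ x ∈ lapEigenspace H t, ∃ c : ℝ, x = c • y) :
    Module.finrank ℝ (lapEigenspace H t) = 1 := by
  rw [finrank_eq_one_iff']
  refine ⟨⟨y, hy⟩, fun e => hy0 (congrArg Subtype.val e), fun w => ?_⟩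
  obtain ⟨c, hc⟩ := h w w.2
  exact ⟨c, Subtype.ext hc.symm⟩

lemma finrank_lapEigenspace_ne_one {V : Type*} [Fintype V] {H : SimpleGraph V} {t : ℝ}
    {x y : V → ℝ} (hx : x ∈ lapEigenspace H t) (hy : y ∈ lapEigenspace H t)
    (h : LinearIndependent ℝ ![x, y]) : Module.finrank ℝ (lapEigenspace H t) ≠ 1 := by
  have h2 : LinearIndependent ℝ ![(⟨x, hx⟩ : lapEigenspace H t), ⟨y, hy⟩] := by
    apply LinearIndependent.of_comp (lapEigenspace H t).subtype
    convert h using 1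
    ext i
    fin_cases i <;> rfl
  have := h2.fintype_card_le_finrank
  simp only [Fintype.card_fin] at this
  omega

lemma isTopLapEigenvalue_of {V : Type*} [Fintype V] {H : SimpleGraph V} {t : ℝ} (ht : 0 < t)
    (hmax : ∀ l, t < l → ∀ x ∈ lapEigenspace H l, x = 0) {y : V → ℝ}
    (hy : y ∈ lapEigenspace H t) (hy0 : y ≠ 0) : IsTopLapEigenvalue H t :=
  ⟨ht, fun l hl => (Submodule.eq_bot_iff _).2 (hmax l hl),
    (Submodule.ne_bot_iff _).2 ⟨y, hy, hy0⟩⟩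

lemma mem_lapEigenspace_star4 (l : ℝ) (x : Fin 4 → ℝ) : x ∈ lapEigenspace (star4Union 4) l ↔
      3 * x 0 - x 1 - x 2 - x 3 = l * x 0 ∧ x 1 - x 0 = l * x 1 ∧ x 2 - x 0 = l * x 2 ∧
        x 3 - x 0 = l * x 3 := by
  classical
  rw [mem_lapEigenspace]
  simp only [star4Union, SimpleGraph.fromRel_adj, Fin.forall_fin_succ, Fin.sum_univ_succ]
  constructor
  · intro h
    simp at h
    obtain ⟨h0, h1, h2, h3⟩ := h
    refine ⟨?_, ?_, ?_, ?_⟩ <;> linarith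
  · rintro ⟨h0, h1, h2, h3⟩
    simp
    refine ⟨?_, ?_, ?_, ?_⟩ <;> linarith

/-- The largest Laplacian eigenvalue of `S_4` is simple. -/
lemma exists_isTopLapEigenvalue_star4 : ∃ t, IsTopLapEigenvalue (star4Union 4) t ∧
    Module.finrank ℝ (lapEigenspace (star4Union 4) t) = 1 := by
  have hy : ![(3 : ℝ), -1, -1, -1] ∈ lapEigenspace (star4Union 4) 4 := by
    rw [mem_lapEigenspace_star4]
    simp
    norm_num
  have hy0 : ![(3 : ℝ), -1, -1, -1] ≠ 0 := fun h => by simpa using congrFun h 0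
  refine ⟨4, isTopLapEigenvalue_of (by positivity) ?_ hy hy0,
    finrank_lapEigenspace_eq_one hy hy0 ?_⟩
  · intro l hl x hx
    obtain ⟨h0, h1, h2, h3⟩ := (mem_lapEigenspace_star4 l x).1 hx
    have hs : x 0 + x 1 + x 2 + x 3 = 0 := by
      refine (mul_eq_zero.1 (?_ : (l) * (x 0 + x 1 + x 2 + x 3) = 0)).resolve_left
        (by linarith : 0 < l).ne'
      linear_combination -h0 - h1 - h2 - h3
    have e0 : x 0 = 0 := by
      refine (mul_eq_zero.1 (?_ : (l - 4) * (x 0) = 0)).resolve_left (by linarith : 0 < l - 4).ne'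
      linear_combination -h0 - hs
    have e1 : x 1 = 0 := by
      refine (mul_eq_zero.1 (?_ : (l - 1) * (x 1) = 0)).resolve_left (by linarith : 0 < l - 1).ne'
      linear_combination -h1 - e0
    have e2 : x 2 = 0 := by
      refine (mul_eq_zero.1 (?_ : (l - 1) * (x 2) = 0)).resolve_left (by linarith : 0 < l - 1).ne'
      linear_combination -h2 - e0
    have e3 : x 3 = 0 := by
      refine (mul_eq_zero.1 (?_ : (l - 1) * (x 3) = 0)).resolve_left (by linarith : 0 < l - 1).ne'
      linear_combination -h3 - e0
    ext i
    fin_cases i <;> simp <;> linarith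
  · intro x hx
    obtain ⟨h0, h1, h2, h3⟩ := (mem_lapEigenspace_star4 _ x).1 hx
    refine ⟨-x 1, ?_⟩
    ext i
    fin_cases i <;> simp <;> linarith

lemma mem_lapEigenspace_cycle4 (l : ℝ) (x : Fin 4 → ℝ) : x ∈ lapEigenspace (cycle4Union 4) l ↔
      2 * x 0 - x 1 - x 3 = l * x 0 ∧ 2 * x 1 - x 0 - x 2 = l * x 1 ∧
        2 * x 2 - x 1 - x 3 = l * x 2 ∧ 2 * x 3 - x 0 - x 2 = l * x 3 := by
  classical
  rw [mem_lapEigenspace]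
  simp only [cycle4Union, SimpleGraph.fromRel_adj, Fin.forall_fin_succ, Fin.sum_univ_succ]
  constructor
  · intro h
    simp at h
    obtain ⟨h0, h1, h2, h3⟩ := h
    refine ⟨?_, ?_, ?_, ?_⟩ <;> linarith
  · rintro ⟨h0, h1, h2, h3⟩
    simp
    refine ⟨?_, ?_, ?_, ?_⟩ <;> linarith

/-- The largest Laplacian eigenvalue of `C_4` is simple. -/
lemma exists_isTopLapEigenvalue_cycle4 : ∃ t, IsTopLapEigenvalue (cycle4Union 4) t ∧
    Module.finrank ℝ (lapEigenspace (cycle4Union 4) t) = 1 := by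
  have hy : ![(1 : ℝ), -1, 1, -1] ∈ lapEigenspace (cycle4Union 4) 4 := by
    rw [mem_lapEigenspace_cycle4]
    simp
    norm_num
  have hy0 : ![(1 : ℝ), -1, 1, -1] ≠ 0 := fun h => by simpa using congrFun h 0
  refine ⟨4, isTopLapEigenvalue_of (by positivity) ?_ hy hy0,
    finrank_lapEigenspace_eq_one hy hy0 ?_⟩
  · intro l hl x hx
    obtain ⟨h0, h1, h2, h3⟩ := (mem_lapEigenspace_cycle4 l x).1 hx
    have hs : x 0 + x 1 + x 2 + x 3 = 0 := by
      refine (mul_eq_zero.1 (?_ : (l) * (x 0 + x 1 + x 2 + x 3) = 0)).resolve_left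
        (by linarith : 0 < l).ne'
      linear_combination -h0 - h1 - h2 - h3
    have e02 : x 0 - x 2 = 0 := by
      refine (mul_eq_zero.1 (?_ : (l - 2) * (x 0 - x 2) = 0)).resolve_left
        (by linarith : 0 < l - 2).ne'
      linear_combination -h0 + h2
    have e13 : x 1 - x 3 = 0 := by
      refine (mul_eq_zero.1 (?_ : (l - 2) * (x 1 - x 3) = 0)).resolve_left
        (by linarith : 0 < l - 2).ne'
      linear_combination -h1 + h3
    have e0 : x 0 = 0 := by
      refine (mul_eq_zero.1 (?_ : (l - 4) * (x 0) = 0)).resolve_left (by linarith : 0 < l - 4).ne'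
      linear_combination -h0 - hs - e02
    ext i
    fin_cases i <;> simp <;> linarith
  · intro x hx
    obtain ⟨h0, h1, h2, h3⟩ := (mem_lapEigenspace_cycle4 _ x).1 hx
    refine ⟨x 0, ?_⟩
    ext i
    fin_cases i <;> simp <;> linarith

lemma mem_lapEigenspace_kite43 (l : ℝ) (x : Fin 4 → ℝ) : x ∈ lapEigenspace (kite43Union 4) l ↔
      3 * x 0 - x 1 - x 2 - x 3 = l * x 0 ∧ 2 * x 1 - x 0 - x 2 = l * x 1 ∧
        2 * x 2 - x 0 - x 1 = l * x 2 ∧ x 3 - x 0 = l * x 3 := by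
  classical
  rw [mem_lapEigenspace]
  simp only [kite43Union, SimpleGraph.fromRel_adj, Fin.forall_fin_succ, Fin.sum_univ_succ]
  constructor
  · intro h
    simp at h
    obtain ⟨h0, h1, h2, h3⟩ := h
    refine ⟨?_, ?_, ?_, ?_⟩ <;> linarith
  · rintro ⟨h0, h1, h2, h3⟩
    simp
    refine ⟨?_, ?_, ?_, ?_⟩ <;> linarith

/-- The largest Laplacian eigenvalue of the kite is simple. -/
lemma exists_isTopLapEigenvalue_kite43 : ∃ t, IsTopLapEigenvalue (kite43Union 4) t ∧
    Module.finrank ℝ (lapEigenspace (kite43Union 4) t) = 1 := by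
  have hy : ![(3 : ℝ), -1, -1, -1] ∈ lapEigenspace (kite43Union 4) 4 := by
    rw [mem_lapEigenspace_kite43]
    simp
    norm_num
  have hy0 : ![(3 : ℝ), -1, -1, -1] ≠ 0 := fun h => by simpa using congrFun h 0
  refine ⟨4, isTopLapEigenvalue_of (by positivity) ?_ hy hy0,
    finrank_lapEigenspace_eq_one hy hy0 ?_⟩
  · intro l hl x hx
    obtain ⟨h0, h1, h2, h3⟩ := (mem_lapEigenspace_kite43 l x).1 hx
    have hs : x 0 + x 1 + x 2 + x 3 = 0 := by
      refine (mul_eq_zero.1 (?_ : (l) * (x 0 + x 1 + x 2 + x 3) = 0)).resolve_left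
        (by linarith : 0 < l).ne'
      linear_combination -h0 - h1 - h2 - h3
    have e0 : x 0 = 0 := by
      refine (mul_eq_zero.1 (?_ : (l - 4) * (x 0) = 0)).resolve_left (by linarith : 0 < l - 4).ne'
      linear_combination -h0 - hs
    have e3 : x 3 = 0 := by
      refine (mul_eq_zero.1 (?_ : (l - 1) * (x 3) = 0)).resolve_left (by linarith : 0 < l - 1).ne'
      linear_combination -h3 - e0
    have e12 : x 1 - x 2 = 0 := by
      refine (mul_eq_zero.1 (?_ : (l - 3) * (x 1 - x 2) = 0)).resolve_left
        (by linarith : 0 < l - 3).ne'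
      linear_combination -h1 + h2
    ext i
    fin_cases i <;> simp <;> linarith
  · intro x hx
    obtain ⟨h0, h1, h2, h3⟩ := (mem_lapEigenspace_kite43 _ x).1 hx
    refine ⟨-x 3, ?_⟩
    ext i
    fin_cases i <;> simp <;> linarith

lemma mem_lapEigenspace_s3K2 (l : ℝ) (x : Fin 5 → ℝ) : x ∈ lapEigenspace (s3K2Union 5) l ↔
      2 * x 0 - x 1 - x 2 = l * x 0 ∧ x 1 - x 0 = l * x 1 ∧ x 2 - x 0 = l * x 2 ∧
        x 3 - x 4 = l * x 3 ∧ x 4 - x 3 = l * x 4 := by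
  classical
  rw [mem_lapEigenspace]
  simp only [s3K2Union, SimpleGraph.fromRel_adj, Fin.forall_fin_succ, Fin.sum_univ_succ]
  constructor
  · intro h
    simp at h
    obtain ⟨h0, h1, h2, h3, h4⟩ := h
    refine ⟨?_, ?_, ?_, ?_, ?_⟩ <;> linarith
  · rintro ⟨h0, h1, h2, h3, h4⟩
    simp
    refine ⟨?_, ?_, ?_, ?_, ?_⟩ <;> linarith

/-- The largest Laplacian eigenvalue of `S_3 ∪ K_2` is simple. -/
lemma exists_isTopLapEigenvalue_s3K2 : ∃ t, IsTopLapEigenvalue (s3K2Union 5) t ∧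
    Module.finrank ℝ (lapEigenspace (s3K2Union 5) t) = 1 := by
  have hy : ![(2 : ℝ), -1, -1, 0, 0] ∈ lapEigenspace (s3K2Union 5) 3 := by
    rw [mem_lapEigenspace_s3K2]
    simp
    norm_num
  have hy0 : ![(2 : ℝ), -1, -1, 0, 0] ≠ 0 := fun h => by simpa using congrFun h 0
  refine ⟨3, isTopLapEigenvalue_of (by positivity) ?_ hy hy0,
    finrank_lapEigenspace_eq_one hy hy0 ?_⟩
  · intro l hl x hx
    obtain ⟨h0, h1, h2, h3, h4⟩ := (mem_lapEigenspace_s3K2 l x).1 hx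
    have hs : x 0 + x 1 + x 2 = 0 := by
      refine (mul_eq_zero.1 (?_ : (l) * (x 0 + x 1 + x 2) = 0)).resolve_left
        (by linarith : 0 < l).ne'
      linear_combination -h0 - h1 - h2
    have e0 : x 0 = 0 := by
      refine (mul_eq_zero.1 (?_ : (l - 3) * (x 0) = 0)).resolve_left (by linarith : 0 < l - 3).ne'
      linear_combination -h0 - hs
    have e1 : x 1 = 0 := by
      refine (mul_eq_zero.1 (?_ : (l - 1) * (x 1) = 0)).resolve_left (by linarith : 0 < l - 1).ne'
      linear_combination -h1 - e0
    have e34 : x 3 + x 4 = 0 := by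
      refine (mul_eq_zero.1 (?_ : (l) * (x 3 + x 4) = 0)).resolve_left (by linarith : 0 < l).ne'
      linear_combination -h3 - h4
    have e3 : x 3 = 0 := by
      refine (mul_eq_zero.1 (?_ : (l - 2) * (x 3) = 0)).resolve_left (by linarith : 0 < l - 2).ne'
      linear_combination -h3 - e34
    ext i
    fin_cases i <;> simp <;> linarith
  · intro x hx
    obtain ⟨h0, h1, h2, h3, h4⟩ := (mem_lapEigenspace_s3K2 _ x).1 hx
    refine ⟨-x 1, ?_⟩
    ext i
    fin_cases i <;> simp <;> linarith

lemma mem_lapEigenspace_diamond (l : ℝ) (x : Fin 4 → ℝ) : x ∈ lapEigenspace diamondGraph l ↔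
      3 * x 0 - x 1 - x 2 - x 3 = l * x 0 ∧ 3 * x 1 - x 0 - x 2 - x 3 = l * x 1 ∧
        2 * x 2 - x 0 - x 1 = l * x 2 ∧ 2 * x 3 - x 0 - x 1 = l * x 3 := by
  classical
  rw [mem_lapEigenspace]
  simp only [diamondGraph, SimpleGraph.fromRel_adj, Fin.forall_fin_succ, Fin.sum_univ_succ]
  constructor
  · intro h
    simp at h
    obtain ⟨h0, h1, h2, h3⟩ := h
    refine ⟨?_, ?_, ?_, ?_⟩ <;> linarith
  · rintro ⟨h0, h1, h2, h3⟩
    simp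
    refine ⟨?_, ?_, ?_, ?_⟩ <;> linarith

/-- The largest Laplacian eigenvalue of the diamond is not simple. -/
lemma exists_isTopLapEigenvalue_diamond : ∃ t, IsTopLapEigenvalue diamondGraph t ∧
    Module.finrank ℝ (lapEigenspace diamondGraph t) ≠ 1 := by
  have hy : ![(1 : ℝ), -1, 0, 0] ∈ lapEigenspace diamondGraph 4 := by
    rw [mem_lapEigenspace_diamond]
    simp
    norm_num
  have hz : ![(1 : ℝ), 1, -1, -1] ∈ lapEigenspace diamondGraph 4 := by
    rw [mem_lapEigenspace_diamond]
    simp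
    norm_num
  have hy0 : ![(1 : ℝ), -1, 0, 0] ≠ 0 := fun h => by simpa using congrFun h 0
  refine ⟨4, isTopLapEigenvalue_of (by positivity) ?_ hy hy0,
    finrank_lapEigenspace_ne_one hy hz ?_⟩
  · intro l hl x hx
    obtain ⟨h0, h1, h2, h3⟩ := (mem_lapEigenspace_diamond l x).1 hx
    have hs : x 0 + x 1 + x 2 + x 3 = 0 := by
      refine (mul_eq_zero.1 (?_ : (l) * (x 0 + x 1 + x 2 + x 3) = 0)).resolve_left
        (by linarith : 0 < l).ne'
      linear_combination -h0 - h1 - h2 - h3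
    have e0 : x 0 = 0 := by
      refine (mul_eq_zero.1 (?_ : (l - 4) * (x 0) = 0)).resolve_left (by linarith : 0 < l - 4).ne'
      linear_combination -h0 - hs
    have e1 : x 1 = 0 := by
      refine (mul_eq_zero.1 (?_ : (l - 4) * (x 1) = 0)).resolve_left (by linarith : 0 < l - 4).ne'
      linear_combination -h1 - hs
    have e2 : x 2 = 0 := by
      refine (mul_eq_zero.1 (?_ : (l - 2) * (x 2) = 0)).resolve_left (by linarith : 0 < l - 2).ne'
      linear_combination -h2 - e0 - e1
    ext i
    fin_cases i <;> simp <;> linarith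
  · rw [LinearIndependent.pair_iff]
    intro a b hab
    have e0 := congrFun hab 0
    have e1 := congrFun hab 1
    have e2 := congrFun hab 2
    simp at e0 e1 e2
    constructor <;> linarith

lemma mem_lapEigenspace_complete4 (l : ℝ) (x : Fin 4 → ℝ) :
    x ∈ lapEigenspace (⊤ : SimpleGraph (Fin 4)) l ↔
      3 * x 0 - x 1 - x 2 - x 3 = l * x 0 ∧ 3 * x 1 - x 0 - x 2 - x 3 = l * x 1 ∧
        3 * x 2 - x 0 - x 1 - x 3 = l * x 2 ∧ 3 * x 3 - x 0 - x 1 - x 2 = l * x 3 := by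
  classical
  rw [mem_lapEigenspace]
  simp only [SimpleGraph.top_adj, Fin.forall_fin_succ, Fin.sum_univ_succ]
  constructor
  · intro h
    simp at h
    obtain ⟨h0, h1, h2, h3⟩ := h
    refine ⟨?_, ?_, ?_, ?_⟩ <;> linarith
  · rintro ⟨h0, h1, h2, h3⟩
    simp
    refine ⟨?_, ?_, ?_, ?_⟩ <;> linarith

/-- The largest Laplacian eigenvalue of `K_4` is not simple. -/
lemma exists_isTopLapEigenvalue_complete4 : ∃ t, IsTopLapEigenvalue (⊤ : SimpleGraph (Fin 4)) t ∧
    Module.finrank ℝ (lapEigenspace (⊤ : SimpleGraph (Fin 4)) t) ≠ 1 := by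
  have hy : ![(1 : ℝ), -1, 0, 0] ∈ lapEigenspace (⊤ : SimpleGraph (Fin 4)) 4 := by
    rw [mem_lapEigenspace_complete4]
    simp
    norm_num
  have hz : ![(1 : ℝ), 0, -1, 0] ∈ lapEigenspace (⊤ : SimpleGraph (Fin 4)) 4 := by
    rw [mem_lapEigenspace_complete4]
    simp
    norm_num
  have hy0 : ![(1 : ℝ), -1, 0, 0] ≠ 0 := fun h => by simpa using congrFun h 0
  refine ⟨4, isTopLapEigenvalue_of (by positivity) ?_ hy hy0,
    finrank_lapEigenspace_ne_one hy hz ?_⟩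
  · intro l hl x hx
    obtain ⟨h0, h1, h2, h3⟩ := (mem_lapEigenspace_complete4 l x).1 hx
    have hs : x 0 + x 1 + x 2 + x 3 = 0 := by
      refine (mul_eq_zero.1 (?_ : (l) * (x 0 + x 1 + x 2 + x 3) = 0)).resolve_left
        (by linarith : 0 < l).ne'
      linear_combination -h0 - h1 - h2 - h3
    have e0 : x 0 = 0 := by
      refine (mul_eq_zero.1 (?_ : (l - 4) * (x 0) = 0)).resolve_left (by linarith : 0 < l - 4).ne'
      linear_combination -h0 - hs
    have e1 : x 1 = 0 := by
      refine (mul_eq_zero.1 (?_ : (l - 4) * (x 1) = 0)).resolve_left (by linarith : 0 < l - 4).ne'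
      linear_combination -h1 - hs
    have e2 : x 2 = 0 := by
      refine (mul_eq_zero.1 (?_ : (l - 4) * (x 2) = 0)).resolve_left (by linarith : 0 < l - 4).ne'
      linear_combination -h2 - hs
    ext i
    fin_cases i <;> simp <;> linarith
  · rw [LinearIndependent.pair_iff]
    intro a b hab
    have e0 := congrFun hab 0
    have e1 := congrFun hab 1
    have e2 := congrFun hab 2
    simp at e0 e1 e2
    constructor <;> linarith

lemma mem_lapEigenspace_triangleUnionEdge (l : ℝ) (x : Fin 5 → ℝ) :
    x ∈ lapEigenspace triangleUnionEdge l ↔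
      2 * x 0 - x 1 - x 2 = l * x 0 ∧ 2 * x 1 - x 0 - x 2 = l * x 1 ∧
        2 * x 2 - x 0 - x 1 = l * x 2 ∧ x 3 - x 4 = l * x 3 ∧ x 4 - x 3 = l * x 4 := by
  classical
  rw [mem_lapEigenspace]
  simp only [triangleUnionEdge, SimpleGraph.fromRel_adj, Fin.forall_fin_succ, Fin.sum_univ_succ]
  constructor
  · intro h
    simp at h
    obtain ⟨h0, h1, h2, h3, h4⟩ := h
    refine ⟨?_, ?_, ?_, ?_, ?_⟩ <;> linarith
  · rintro ⟨h0, h1, h2, h3, h4⟩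
    simp
    refine ⟨?_, ?_, ?_, ?_, ?_⟩ <;> linarith

/-- The largest Laplacian eigenvalue of `K_3 ∪ K_2` is not simple. -/
lemma exists_isTopLapEigenvalue_triangleUnionEdge : ∃ t, IsTopLapEigenvalue triangleUnionEdge t ∧
    Module.finrank ℝ (lapEigenspace triangleUnionEdge t) ≠ 1 := by
  have hy : ![(1 : ℝ), -1, 0, 0, 0] ∈ lapEigenspace triangleUnionEdge 3 := by
    rw [mem_lapEigenspace_triangleUnionEdge]
    simp
    norm_num
  have hz : ![(1 : ℝ), 0, -1, 0, 0] ∈ lapEigenspace triangleUnionEdge 3 := by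
    rw [mem_lapEigenspace_triangleUnionEdge]
    simp
    norm_num
  have hy0 : ![(1 : ℝ), -1, 0, 0, 0] ≠ 0 := fun h => by simpa using congrFun h 0
  refine ⟨3, isTopLapEigenvalue_of (by positivity) ?_ hy hy0,
    finrank_lapEigenspace_ne_one hy hz ?_⟩
  · intro l hl x hx
    obtain ⟨h0, h1, h2, h3, h4⟩ := (mem_lapEigenspace_triangleUnionEdge l x).1 hx
    have hs : x 0 + x 1 + x 2 = 0 := by
      refine (mul_eq_zero.1 (?_ : (l) * (x 0 + x 1 + x 2) = 0)).resolve_left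
        (by linarith : 0 < l).ne'
      linear_combination -h0 - h1 - h2
    have e0 : x 0 = 0 := by
      refine (mul_eq_zero.1 (?_ : (l - 3) * (x 0) = 0)).resolve_left (by linarith : 0 < l - 3).ne'
      linear_combination -h0 - hs
    have e1 : x 1 = 0 := by
      refine (mul_eq_zero.1 (?_ : (l - 3) * (x 1) = 0)).resolve_left (by linarith : 0 < l - 3).ne'
      linear_combination -h1 - hs
    have e34 : x 3 + x 4 = 0 := by
      refine (mul_eq_zero.1 (?_ : (l) * (x 3 + x 4) = 0)).resolve_left (by linarith : 0 < l).ne'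
      linear_combination -h3 - h4
    have e3 : x 3 = 0 := by
      refine (mul_eq_zero.1 (?_ : (l - 2) * (x 3) = 0)).resolve_left (by linarith : 0 < l - 2).ne'
      linear_combination -h3 - e34
    ext i
    fin_cases i <;> simp <;> linarith
  · rw [LinearIndependent.pair_iff]
    intro a b hab
    have e0 := congrFun hab 0
    have e1 := congrFun hab 1
    have e2 := congrFun hab 2
    simp at e0 e1 e2
    constructor <;> linarith

lemma mem_lapEigenspace_threeEdges (l : ℝ) (x : Fin 6 → ℝ) : x ∈ lapEigenspace threeEdges l ↔
      x 0 - x 1 = l * x 0 ∧ x 1 - x 0 = l * x 1 ∧ x 2 - x 3 = l * x 2 ∧ x 3 - x 2 = l * x 3 ∧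
        x 4 - x 5 = l * x 4 ∧ x 5 - x 4 = l * x 5 := by
  classical
  rw [mem_lapEigenspace]
  simp only [threeEdges, SimpleGraph.fromRel_adj, Fin.forall_fin_succ, Fin.sum_univ_succ]
  constructor
  · intro h
    simp at h
    obtain ⟨h0, h1, h2, h3, h4, h5⟩ := h
    refine ⟨?_, ?_, ?_, ?_, ?_, ?_⟩ <;> linarith
  · rintro ⟨h0, h1, h2, h3, h4, h5⟩
    simp
    refine ⟨?_, ?_, ?_, ?_, ?_, ?_⟩ <;> linarith

/-- The largest Laplacian eigenvalue of `3 K_2` is not simple. -/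
lemma exists_isTopLapEigenvalue_threeEdges : ∃ t, IsTopLapEigenvalue threeEdges t ∧
    Module.finrank ℝ (lapEigenspace threeEdges t) ≠ 1 := by
  have hy : ![(1 : ℝ), -1, 0, 0, 0, 0] ∈ lapEigenspace threeEdges 2 := by
    rw [mem_lapEigenspace_threeEdges]
    simp
    norm_num
  have hz : ![(0 : ℝ), 0, 1, -1, 0, 0] ∈ lapEigenspace threeEdges 2 := by
    rw [mem_lapEigenspace_threeEdges]
    simp
    norm_num
  have hy0 : ![(1 : ℝ), -1, 0, 0, 0, 0] ≠ 0 := fun h => by simpa using congrFun h 0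
  refine ⟨2, isTopLapEigenvalue_of (by positivity) ?_ hy hy0,
    finrank_lapEigenspace_ne_one hy hz ?_⟩
  · intro l hl x hx
    obtain ⟨h0, h1, h2, h3, h4, h5⟩ := (mem_lapEigenspace_threeEdges l x).1 hx
    have e01 : x 0 + x 1 = 0 := by
      refine (mul_eq_zero.1 (?_ : (l) * (x 0 + x 1) = 0)).resolve_left (by linarith : 0 < l).ne'
      linear_combination -h0 - h1
    have e0 : x 0 = 0 := by
      refine (mul_eq_zero.1 (?_ : (l - 2) * (x 0) = 0)).resolve_left (by linarith : 0 < l - 2).ne'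
      linear_combination -h0 - e01
    have e23 : x 2 + x 3 = 0 := by
      refine (mul_eq_zero.1 (?_ : (l) * (x 2 + x 3) = 0)).resolve_left (by linarith : 0 < l).ne'
      linear_combination -h2 - h3
    have e2 : x 2 = 0 := by
      refine (mul_eq_zero.1 (?_ : (l - 2) * (x 2) = 0)).resolve_left (by linarith : 0 < l - 2).ne'
      linear_combination -h2 - e23
    have e45 : x 4 + x 5 = 0 := by
      refine (mul_eq_zero.1 (?_ : (l) * (x 4 + x 5) = 0)).resolve_left (by linarith : 0 < l).ne'
      linear_combination -h4 - h5
    have e4 : x 4 = 0 := by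
      refine (mul_eq_zero.1 (?_ : (l - 2) * (x 4) = 0)).resolve_left (by linarith : 0 < l - 2).ne'
      linear_combination -h4 - e45
    ext i
    fin_cases i <;> simp <;> linarith
  · rw [LinearIndependent.pair_iff]
    intro a b hab
    have e0 := congrFun hab 0
    have e1 := congrFun hab 1
    have e2 := congrFun hab 2
    simp at e0 e1 e2
    constructor <;> linarith

lemma mem_lapEigenspace_path4 (l : ℝ) (x : Fin 4 → ℝ) : x ∈ lapEigenspace (path4Union 4) l ↔
      x 0 - x 1 = l * x 0 ∧ 2 * x 1 - x 0 - x 2 = l * x 1 ∧ 2 * x 2 - x 1 - x 3 = l * x 2 ∧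
        x 3 - x 2 = l * x 3 := by
  classical
  rw [mem_lapEigenspace]
  simp only [path4Union, SimpleGraph.fromRel_adj, Fin.forall_fin_succ, Fin.sum_univ_succ]
  constructor
  · intro h
    simp at h
    obtain ⟨h0, h1, h2, h3⟩ := h
    refine ⟨?_, ?_, ?_, ?_⟩ <;> linarith
  · rintro ⟨h0, h1, h2, h3⟩
    simp
    refine ⟨?_, ?_, ?_, ?_⟩ <;> linarith

/-- The largest Laplacian eigenvalue of `P_4` is simple. -/
lemma exists_isTopLapEigenvalue_path4 : ∃ t, IsTopLapEigenvalue (path4Union 4) t ∧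
    Module.finrank ℝ (lapEigenspace (path4Union 4) t) = 1 := by
  obtain ⟨s, hs0, hs⟩ : ∃ s : ℝ, 0 < s ∧ s * s = 2 :=
    ⟨√2, by positivity, Real.mul_self_sqrt (by norm_num)⟩
  have hy : ![(1 : ℝ), -(1 + s), 1 + s, -1] ∈ lapEigenspace (path4Union 4) (2 + s) := by
    rw [mem_lapEigenspace_path4]
    simp
    refine ⟨?_, ?_, ?_, ?_⟩ <;> linarith
  have hy0 : ![(1 : ℝ), -(1 + s), 1 + s, -1] ≠ 0 := fun h => by simpa using congrFun h 0
  refine ⟨2 + s, isTopLapEigenvalue_of (by positivity) ?_ hy hy0,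
    finrank_lapEigenspace_eq_one hy hy0 ?_⟩
  · intro l hl x hx
    obtain ⟨h0, h1, h2, h3⟩ := (mem_lapEigenspace_path4 l x).1 hx
    have hl' : 0 < (l - 2) ^ 2 - 2 := by nlinarith
    have hp : x 0 + x 3 = 0 := by
      refine (mul_eq_zero.1 (?_ : (l * (l - 2)) * (x 0 + x 3) = 0)).resolve_left
        (mul_pos (by linarith) (by linarith)).ne'
      linear_combination (1 - l) * (h0 + h3) + h1 + h2
    have hm : x 0 - x 3 = 0 := by
      refine (mul_eq_zero.1 (?_ : ((l - 2) ^ 2 - 2) * (x 0 - x 3) = 0)).resolve_left hl'.ne'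
      linear_combination (3 - l) * (h0 - h3) + h1 - h2
    have e0 : x 0 = 0 := by linarith
    have e3 : x 3 = 0 := by linarith
    rw [e0] at h0
    rw [e3] at h3
    ext i
    fin_cases i <;> simp <;> linarith
  · intro x hx
    obtain ⟨h0, h1, h2, h3⟩ := (mem_lapEigenspace_path4 _ x).1 hx
    have e1 : x 1 = -(1 + s) * x 0 := by linear_combination -h0
    have e2 : x 2 = (1 + s) * x 0 := by linear_combination -h1 - s * e1 + x 0 * hs
    have e3 : x 3 = - x 0 := by linear_combination -h2 - s * e2 - e1 - x 0 * hs
    refine ⟨x 0, ?_⟩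
    ext i
    fin_cases i <;> simp <;> linarith

/-- A nonzero Laplacian eigenvalue has the same multiplicity after adding isolated vertices. -/
lemma IsCopyWithIsolated.exists_isTopLapEigenvalue {m : ℕ} {V : Type*} [Fintype V]
    {K : SimpleGraph (Fin m)} {H : SimpleGraph V} (h : IsCopyWithIsolated K H) {p : ℕ → Prop}
    (hK : ∃ t, IsTopLapEigenvalue K t ∧ p (Module.finrank ℝ (lapEigenspace K t))) :
    ∃ t, IsTopLapEigenvalue H t ∧ p (Module.finrank ℝ (lapEigenspace H t)) := by
  obtain ⟨f, rfl⟩ := h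
  obtain ⟨t, ht, hp⟩ := hK
  exact ⟨t, ht.map f, by rwa [finrank_lapEigenspace_map K f ht.1.ne']⟩

/-- For a connected graph `G` on `n ≥ 5` vertices: `n` is a distance Laplacian eigenvalue
of multiplicity `n - 4` and the largest distance Laplacian eigenvalue is simple iff `G` is
the complement of one of `S_4 ∪ (n-4)K_1`, `C_4 ∪ (n-4)K_1`, `P_4 ∪ (n-4)K_1`,
`Ki_{4,3} ∪ (n-4)K_1`, `S_3 ∪ K_2 ∪ (n-5)K_1`. -/
theorem stmt_15 (n : ℕ) (hn : 5 ≤ n) (G : SimpleGraph (Fin n)) (hG : G.Connected)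
    (M : Matrix (Fin n) (Fin n) ℝ) (hM : M = distLapMatrix G) :
    (eigMult M (n : ℝ) = n - 4 ∧
      (∃ μ : ℝ, IsEigenvalue M μ ∧ (∀ ν : ℝ, IsEigenvalue M ν → ν ≤ μ) ∧
        eigMult M μ = 1)) ↔
      (Nonempty (G ≃g (star4Union n)ᶜ) ∨
       Nonempty (G ≃g (cycle4Union n)ᶜ) ∨
       Nonempty (G ≃g (path4Union n)ᶜ) ∨
       Nonempty (G ≃g (kite43Union n)ᶜ) ∨
       Nonempty (G ≃g (s3K2Union n)ᶜ)) := by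
  subst hM
  have : Nonempty (Fin n) := hG.nonempty
  have hmult := eigMult_card_add_one hG
  rw [Fintype.card_fin] at hmult
  rw [nonempty_iso_compl_iff (by omega) _ _ G (star4Union_eq_map (by omega)),
    nonempty_iso_compl_iff (by omega) _ _ G (cycle4Union_eq_map (by omega)),
    nonempty_iso_compl_iff (by omega) _ _ G (path4Union_eq_map (by omega)),
    nonempty_iso_compl_iff (by omega) _ _ G (kite43Union_eq_map (by omega)),
    nonempty_iso_compl_iff hn _ _ G (s3K2Union_eq_map hn)]
  constructor
  · rintro ⟨hmul, hmax⟩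
    have hc : 2 ≤ Nat.card Gᶜ.ConnectedComponent := by omega
    have key : ¬ ∃ t, IsTopLapEigenvalue Gᶜ t ∧
        Module.finrank ℝ (lapEigenspace Gᶜ t) ≠ 1 :=
      fun ⟨t, ht, hne⟩ => hne ((largest_simple_iff hc ht).1 hmax)
    rcases classification_of_card_connectedComponent (H := Gᶜ)
      (by rw [Fintype.card_fin]; omega) with h | h | h | h | h
    · exact h
    · exact (key (h.exists_isTopLapEigenvalue (p := (· ≠ 1))
        exists_isTopLapEigenvalue_diamond)).elim
    · exact (key (h.exists_isTopLapEigenvalue (p := (· ≠ 1))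
        exists_isTopLapEigenvalue_complete4)).elim
    · exact (key (h.exists_isTopLapEigenvalue (p := (· ≠ 1))
        exists_isTopLapEigenvalue_triangleUnionEdge)).elim
    · exact (key (h.exists_isTopLapEigenvalue (p := (· ≠ 1))
        exists_isTopLapEigenvalue_threeEdges)).elim
  · intro h
    have hcard := card_connectedComponent_of_pattern h
    rw [Fintype.card_fin] at hcard
    have hc : 2 ≤ Nat.card Gᶜ.ConnectedComponent := by omega
    obtain ⟨t, ht, h1⟩ : ∃ t, IsTopLapEigenvalue Gᶜ t ∧
        Module.finrank ℝ (lapEigenspace Gᶜ t) = 1 := by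
      rcases h with h | h | h | h | h
      · exact h.exists_isTopLapEigenvalue (p := (· = 1)) exists_isTopLapEigenvalue_star4
      · exact h.exists_isTopLapEigenvalue (p := (· = 1)) exists_isTopLapEigenvalue_cycle4
      · exact h.exists_isTopLapEigenvalue (p := (· = 1)) exists_isTopLapEigenvalue_path4
      · exact h.exists_isTopLapEigenvalue (p := (· = 1)) exists_isTopLapEigenvalue_kite43
      · exact h.exists_isTopLapEigenvalue (p := (· = 1)) exists_isTopLapEigenvalue_s3K2
    exact ⟨by omega, (largest_simple_iff hc ht).2 h1⟩
end
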